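/- arXiv:2206.11543 — 5 statements merged into one kernel-verified Lean document; each statement's English description precedes it below -/
import Mathlib

section
/- Let u ∈ ℓ²(ℕ, ℂ). Then the maximal Hankel operator Γ_u coincides with the closure of its restriction to finitely supported sequences; that is, the graph {(f, Γ_u f) : f ∈ Dom Γ_u} ⊆ ℓ² × ℓ² equals the closure (in ℓ² × ℓ²) of the set {(p, Γ_u p) : p finitely supported}. -/
open scoped ComplexConjugate
open Filter

noncomputable section

/-- `ℓ²(ℕ, ℂ)`. -/
abbrev ellTwo : Type := lp (fun _ : ℕ => ℂ) 2

/-- The (maximal) Hankel matrix action with symbol `u`: `(Γ_u f)(m) = ∑_{n} u(n+m) f(n)`. -/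
def hankel (u f : ℕ → ℂ) : ℕ → ℂ := fun m => ∑' n : ℕ, u (n + m) * f n

/-- Finitely supported sequences. -/
def FinSupp (p : ℕ → ℂ) : Prop := ∃ N, ∀ n ≥ N, p n = 0

theorem isometry_pow_add_apply {E : Type*} [SeminormedAddCommGroup E] [Module ℂ E]
    (S : E →ₗᵢ[ℂ] E) (m n : ℕ) (x : E) : (S ^ (m + n)) x = (S ^ m) ((S ^ n) x) := by
  rw [pow_add]
  rfl

/-- The standard basis of `ℓ²(ℕ, ℂ)`. -/
def stdVec (n : ℕ) : ellTwo := lp.single 2 n 1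

theorem stdVec_apply (n k : ℕ) : stdVec n k = if k = n then 1 else 0 := by
  simp [stdVec, Pi.single_apply]

theorem norm_stdVec (n : ℕ) : ‖stdVec n‖ = 1 := by
  simp [stdVec, lp.norm_single]

theorem inner_stdVec_left (n : ℕ) (x : ellTwo) : inner ℂ (stdVec n) x = x n := by
  simp [stdVec, lp.inner_single_left]

theorem orthonormal_stdVec : Orthonormal ℂ stdVec :=
  ⟨norm_stdVec, fun i j h => by
    change inner ℂ (stdVec i) (stdVec j) = 0
    rw [inner_stdVec_left, stdVec_apply, if_neg h]⟩

theorem hasSum_stdVec (x : ellTwo) : HasSum (fun n => x n • stdVec n) x := by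
  convert! lp.hasSum_single (p := 2) (by norm_num) x using 2 with n
  rw [stdVec, ← lp.single_smul, smul_eq_mul, mul_one]

theorem clm_ext_stdVec {F : Type*} [NormedAddCommGroup F] [NormedSpace ℂ F]
    {A B : ellTwo →L[ℂ] F} (h : ∀ n, A (stdVec n) = B (stdVec n)) (x : ellTwo) : A x = B x := by
  have hA := (hasSum_stdVec x).mapL A
  have hB := (hasSum_stdVec x).mapL B
  simp only [map_smul, h] at hA hB
  exact hA.unique hB

/-- An orthonormal sequence in a Hilbert space is the image of the standard basis of `ℓ²`
under a linear isometry. -/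
theorem exists_isometry_of_orthonormal {E : Type*} [NormedAddCommGroup E]
    [InnerProductSpace ℂ E] [CompleteSpace E] {w : ℕ → E} (hw : Orthonormal ℂ w) :
    ∃ V : ellTwo →ₗᵢ[ℂ] E, ∀ n, V (stdVec n) = w n :=
  ⟨hw.orthogonalFamily.linearIsometry, fun n => by
    rw [stdVec, OrthogonalFamily.linearIsometry_apply_single]
    simp [LinearIsometry.toSpanSingleton_apply]⟩

theorem exists_shift : ∃ S : ellTwo →ₗᵢ[ℂ] ellTwo, ∀ n, S (stdVec n) = stdVec (n + 1) :=
  exists_isometry_of_orthonormal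
    (orthonormal_stdVec.comp (fun n => n + 1) (add_left_injective 1))

/-- The unilateral shift on `ℓ²(ℕ, ℂ)`. -/
def shift : ellTwo →ₗᵢ[ℂ] ellTwo := exists_shift.choose

theorem shift_stdVec (n : ℕ) : shift (stdVec n) = stdVec (n + 1) := exists_shift.choose_spec n

theorem shift_pow_stdVec (m n : ℕ) : (shift ^ m) (stdVec n) = stdVec (n + m) := by
  induction m with
  | zero => simp
  | succ m ih =>
    rw [add_comm m 1, isometry_pow_add_apply, ih, pow_one, shift_stdVec, add_comm 1 m, add_assoc]

/-- The coordinate functional `x ↦ x k`. -/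
def coord (k : ℕ) : ellTwo →L[ℂ] ℂ := innerSL ℂ (stdVec k)

theorem coord_apply (k : ℕ) (x : ellTwo) : coord k x = x k := by
  simp [coord, inner_stdVec_left]

theorem shift_pow_apply (m : ℕ) (x : ellTwo) (k : ℕ) :
    (shift ^ m) x k = if m ≤ k then x (k - m) else 0 := by
  have h := clm_ext_stdVec (A := (coord k).comp (shift ^ m).toContinuousLinearMap)
    (B := if m ≤ k then coord (k - m) else 0) (fun n => by
      split_ifs with hk <;>
      simp only [ContinuousLinearMap.comp_apply, LinearIsometry.coe_toContinuousLinearMap,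
        shift_pow_stdVec, coord_apply, stdVec_apply, zero_apply] <;> grind) x
  rw [ContinuousLinearMap.comp_apply, coord_apply] at h
  rw [← LinearIsometry.coe_toContinuousLinearMap, h]
  split_ifs <;> simp [coord_apply]

/-- The bilinear pairing `∑ₙ x(n) y(n)`, as a continuous functional of `y`. -/
def pairing (x : ellTwo) : ellTwo →L[ℂ] ℂ := innerSL ℂ (star x)

theorem hasSum_pairing (x y : ellTwo) : HasSum (fun n => x n * y n) (pairing x y) := by
  simpa [pairing, lp.coeFn_star, mul_comm] using lp.hasSum_inner (𝕜 := ℂ) (star x) y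

theorem pairing_stdVec (x : ellTwo) (n : ℕ) : pairing x (stdVec n) = x n := by
  rw [pairing, innerSL_apply_apply, ← inner_conj_symm, inner_stdVec_left]
  simp

theorem pairing_smul_left (c : ℂ) (x y : ellTwo) : pairing (c • x) y = c * pairing x y := by
  refine (hasSum_pairing _ _).unique ?_
  simpa [mul_assoc] using (hasSum_pairing x y).mul_left c

theorem pairing_comm (x y : ellTwo) : pairing x y = pairing y x := by
  refine (hasSum_pairing x y).unique ?_
  simpa only [mul_comm] using hasSum_pairing y x

theorem hankel_apply (u f : ellTwo) (m : ℕ) : hankel u f m = pairing u ((shift ^ m) f) := by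
  have h := hasSum_pairing u ((shift ^ m) f)
  have hz : ∀ n ∉ Set.range (fun n => n + m), u n * (shift ^ m) f n = 0 := by
    intro n hn
    rw [shift_pow_apply, if_neg, mul_zero]
    exact fun hmn => hn ⟨n - m, Nat.sub_add_cancel hmn⟩
  rw [← (add_left_injective m).hasSum_iff hz] at h
  rw [hankel, ← h.tsum_eq]
  refine tsum_congr fun n => ?_
  simp [shift_pow_apply]

/-- An operator mapping `zⁿ` to `zⁿ ψ` acts by convolution with `ψ`. -/
theorem apply_eq_sum_antidiagonal {A : ellTwo →L[ℂ] ellTwo}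
    (hA : ∀ n, A (stdVec n) = (shift ^ n) (A (stdVec 0))) (x : ellTwo) (k : ℕ) :
    A x k = ∑ ij ∈ Finset.HasAntidiagonal.antidiagonal k, A (stdVec 0) ij.1 * x ij.2 := by
  have h := clm_ext_stdVec (A := (coord k).comp A)
    (B := ∑ ij ∈ Finset.HasAntidiagonal.antidiagonal k, A (stdVec 0) ij.1 • coord ij.2) (fun n => by
      simp only [ContinuousLinearMap.comp_apply, sum_apply,
        smul_apply, coord_apply, stdVec_apply, smul_eq_mul]
      rw [hA, shift_pow_apply, Finset.Nat.sum_antidiagonal_eq_sum_range_succ_mk]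
      simp only [mul_ite, mul_one, mul_zero]
      split_ifs with hn
      · rw [Finset.sum_eq_single (k - n)]
        · rw [if_pos (by omega)]
        · intro i hi hne
          rw [if_neg]
          simp only [Finset.mem_range] at hi
          omega
        · intro hi
          exact absurd (Finset.mem_range.2 (by omega)) hi
      · refine (Finset.sum_eq_zero fun i hi => ?_).symm
        rw [if_neg (by omega)]) x
  simpa [coord_apply] using h

/-- The wandering vector of the cyclic subspace generated by `w` under an isometry. -/
theorem exists_wandering {E : Type*} [NormedAddCommGroup E] [InnerProductSpace ℂ E]
    [CompleteSpace E] (S : E →ₗᵢ[ℂ] E) (w : E) :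
    ∃ v : E, ‖v‖ ≤ ‖w‖ ∧ (∀ n, inner ℂ v ((S ^ (n + 1)) v) = 0) ∧
      (∀ L : E →L[ℂ] ℂ, (∀ n, L ((S ^ n) w) = 0) → L v = 0) ∧
      (∀ L : E →L[ℂ] ℂ, (∀ n, L ((S ^ (n + 1)) w) = 0) → L v = L w) := by
  set K : Submodule ℂ E :=
    (Submodule.span ℂ (Set.range fun n : ℕ => (S ^ (n + 1)) w)).topologicalClosure with hK
  have hKc : IsClosed (K : Set E) := Submodule.isClosed_topologicalClosure _
  have : CompleteSpace K := hKc.completeSpace_coe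
  have hmem : ∀ n : ℕ, (S ^ (n + 1)) w ∈ K := fun n =>
    Submodule.le_topologicalClosure _ (Submodule.subset_span ⟨n, rfl⟩)
  have hmin : ∀ M : Submodule ℂ E, IsClosed (M : Set E) → (∀ n : ℕ, (S ^ (n + 1)) w ∈ M) →
      K ≤ M := fun M hM h => Submodule.topologicalClosure_minimal _
    (Submodule.span_le.2 (by rintro _ ⟨n, rfl⟩; exact h n)) hM
  have hker : ∀ L : E →L[ℂ] ℂ, (∀ n, L ((S ^ (n + 1)) w) = 0) → ∀ x ∈ K, L x = 0 := by
    intro L hL x hx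
    exact hmin (LinearMap.ker L.toLinearMap) L.isClosed_ker (fun n => hL n) hx
  have hP : K.starProjection w ∈ K := K.starProjection_apply_mem w
  have hstable : ∀ n : ℕ, ∀ x ∈ K, (S ^ (n + 1)) x ∈ K := by
    intro n x hx
    refine hmin (K.comap (S ^ (n + 1)).toLinearMap)
      (hKc.preimage (S ^ (n + 1)).continuous) (fun m => ?_) hx
    change (S ^ (n + 1)) ((S ^ (m + 1)) w) ∈ K
    rw [← isometry_pow_add_apply]
    exact hmem (n + 1 + m)
  refine ⟨w - K.starProjection w, ?_, fun n => ?_, fun L hL => ?_, fun L hL => ?_⟩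
  · have h := norm_sub_sq (𝕜 := ℂ) w (K.starProjection w)
    have h2 : inner ℂ w (K.starProjection w) =
        inner ℂ (K.starProjection w) (K.starProjection w) := by
      have := K.starProjection_inner_eq_zero w _ hP
      rwa [inner_sub_left, sub_eq_zero] at this
    rw [h2, inner_self_eq_norm_sq] at h
    refine (sq_le_sq₀ (norm_nonneg _) (norm_nonneg _)).1 ?_
    nlinarith [sq_nonneg ‖K.starProjection w‖]
  · refine K.starProjection_inner_eq_zero w _ ?_
    rw [map_sub]
    exact K.sub_mem (hmem n) (hstable n _ hP)
  · rw [map_sub, hker L (fun n => hL (n + 1)) _ hP, sub_zero]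
    simpa using hL 0
  · rw [map_sub, hker L hL _ hP, sub_zero]

theorem orthonormal_orbit {E : Type*} [NormedAddCommGroup E] [InnerProductSpace ℂ E]
    (S : E →ₗᵢ[ℂ] E) {v : E} (hv : ‖v‖ = 1) (h : ∀ n, inner ℂ v ((S ^ (n + 1)) v) = 0) :
    Orthonormal ℂ fun n : ℕ => (S ^ n) v := by
  have hlt : ∀ i j : ℕ, i < j → inner ℂ ((S ^ i) v) ((S ^ j) v) = 0 := by
    intro i j hij
    obtain ⟨k, rfl⟩ := Nat.exists_eq_add_of_lt hij
    rw [add_assoc, isometry_pow_add_apply, LinearIsometry.inner_map_map, h]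
  refine ⟨fun n => by rw [LinearIsometry.norm_map, hv], fun i j hij => ?_⟩
  rcases lt_or_gt_of_ne hij with hij | hij
  · exact hlt i j hij
  · rw [← inner_conj_symm, hlt j i hij, map_zero]

/-- For `f` in the domain of the Hankel operator with symbol `u` and `g = Γ_u f`, there are bounded
analytic multiplication operators `A` and `B` with `B 1 = A f`, that is, `A = M_ψ` and `B = M_{ψ f}`,
which intertwine the functionals induced by `u` and `g`. -/
theorem exists_multiplier (u f g : ellTwo) (h : ∀ m, g m = pairing u ((shift ^ m) f)) :
    ∃ A B : ellTwo →L[ℂ] ellTwo, (∀ n, A (stdVec n) = (shift ^ n) (A (stdVec 0))) ∧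
      (∀ n, B (stdVec n) = (shift ^ n) (B (stdVec 0))) ∧ B (stdVec 0) = A f ∧
      (∀ x, pairing u (B x) = pairing g (A x)) ∧ (∀ x, ‖A x‖ ≤ (1 + ‖f‖) * ‖x‖) ∧
      ‖A (stdVec 0) - stdVec 0‖ ≤ ‖f‖ := by
  let S := shift.withLpProdMap 2 shift
  let w : WithLp 2 (ellTwo × ellTwo) := WithLp.toLp 2 (stdVec 0, f)
  let P := WithLp.fstL 2 ℂ ellTwo ellTwo
  let Q := WithLp.sndL 2 ℂ ellTwo ellTwo
  have hS : ∀ n x, P ((S ^ n) x) = (shift ^ n) (P x) ∧ Q ((S ^ n) x) = (shift ^ n) (Q x) := by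
    intro n
    induction n with
    | zero => exact fun x => ⟨rfl, rfl⟩
    | succ n ih =>
      intro x
      rw [isometry_pow_add_apply, isometry_pow_add_apply, isometry_pow_add_apply, (ih _).1,
        (ih _).2, pow_one, pow_one]
      exact ⟨rfl, rfl⟩
  have hPw : P w = stdVec 0 := rfl
  have hQw : Q w = f := rfl
  obtain ⟨v, hvw, horth, hv, hvw'⟩ := exists_wandering S w
  have hv0 : P v 0 = 1 := by
    have := hvw' ((coord 0).comp P) (fun n => by
      rw [ContinuousLinearMap.comp_apply, (hS _ _).1, coord_apply, shift_pow_apply,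
        if_neg (by omega)])
    simpa [coord_apply, hPw, stdVec_apply] using this
  have hne : v ≠ 0 := by
    rintro rfl
    simp at hv0
  have hnorm : ‖v‖ ≠ 0 := norm_ne_zero_iff.2 hne
  have hnormC : (‖v‖ : ℂ) ≠ 0 := by exact_mod_cast hnorm
  have hwsq : ‖w‖ ^ 2 = 1 + ‖f‖ ^ 2 := by
    rw [WithLp.prod_norm_sq_eq_of_L2]
    change ‖stdVec 0‖ ^ 2 + ‖f‖ ^ 2 = _
    rw [norm_stdVec, one_pow]
  have hvsq : ‖v‖ ^ 2 ≤ 1 + ‖f‖ ^ 2 := by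
    rw [← hwsq]
    exact pow_le_pow_left₀ (norm_nonneg _) hvw 2
  have hvle : ‖v‖ ≤ 1 + ‖f‖ := by
    nlinarith [norm_nonneg v, norm_nonneg f]
  have hPle : ∀ x, ‖P x‖ ≤ ‖x‖ := by
    intro x
    refine (sq_le_sq₀ (norm_nonneg _) (norm_nonneg _)).1 ?_
    rw [WithLp.prod_norm_sq_eq_of_L2]
    exact le_add_of_nonneg_right (sq_nonneg _)
  obtain ⟨V, hV⟩ := exists_isometry_of_orthonormal
    (orthonormal_orbit S (v := (‖v‖ : ℂ)⁻¹ • v) (by simp [norm_smul, hnorm]) (fun n => by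
      rw [map_smul, inner_smul_left, inner_smul_right, horth, mul_zero, mul_zero]))
  let A : ellTwo →L[ℂ] ellTwo := (‖v‖ : ℂ) • P.comp V.toContinuousLinearMap
  let B : ellTwo →L[ℂ] ellTwo := (‖v‖ : ℂ) • Q.comp V.toContinuousLinearMap
  have hA : ∀ n, A (stdVec n) = (shift ^ n) (P v) := by
    intro n
    change (‖v‖ : ℂ) • P (V (stdVec n)) = _
    rw [hV, map_smul, map_smul, smul_smul, mul_inv_cancel₀ hnormC, one_smul, (hS n v).1]
  have hB : ∀ n, B (stdVec n) = (shift ^ n) (Q v) := by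
    intro n
    change (‖v‖ : ℂ) • Q (V (stdVec n)) = _
    rw [hV, map_smul, map_smul, smul_smul, mul_inv_cancel₀ hnormC, one_smul, (hS n v).2]
  have hA0 : A (stdVec 0) = P v := by simp [hA 0]
  have hB0 : B (stdVec 0) = Q v := by simp [hB 0]
  have hA' : ∀ n, A (stdVec n) = (shift ^ n) (A (stdVec 0)) := fun n => by rw [hA0, hA]
  refine ⟨A, B, hA', fun n => by rw [hB0, hB], ?_, fun x => ?_, fun x => ?_, ?_⟩
  · refine lp.ext (funext fun k => ?_)
    rw [apply_eq_sum_antidiagonal hA', hA0, hB0]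
    have := hv ((coord k).comp Q - ∑ ij ∈ Finset.HasAntidiagonal.antidiagonal k,
      f ij.2 • (coord ij.1).comp P) (fun n => by
        have hf := apply_eq_sum_antidiagonal (A := (shift ^ n).toContinuousLinearMap)
          (fun m => by
            simp only [LinearIsometry.coe_toContinuousLinearMap, shift_pow_stdVec]
            ring_nf) f k
        simp only [LinearIsometry.coe_toContinuousLinearMap] at hf
        simp only [sub_apply, ContinuousLinearMap.comp_apply,
          sum_apply, smul_apply, smul_eq_mul, coord_apply]
        rw [(hS n w).1, (hS n w).2, hPw, hQw, hf, sub_eq_zero]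
        exact Finset.sum_congr rfl fun ij _ => mul_comm _ _)
    simp only [sub_apply, ContinuousLinearMap.comp_apply, sum_apply,
      smul_apply, smul_eq_mul, coord_apply, sub_eq_zero] at this
    rw [this]
    exact Finset.sum_congr rfl fun ij _ => mul_comm _ _
  · refine clm_ext_stdVec (A := (pairing u).comp B) (B := (pairing g).comp A) (fun n => ?_) x
    rw [ContinuousLinearMap.comp_apply, ContinuousLinearMap.comp_apply, hA, hB]
    have := hv (((pairing u).comp (shift ^ n).toContinuousLinearMap).comp Q -
      ((pairing g).comp (shift ^ n).toContinuousLinearMap).comp P) (fun m => by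
        simp only [sub_apply, ContinuousLinearMap.comp_apply,
          LinearIsometry.coe_toContinuousLinearMap]
        rw [(hS m w).1, (hS m w).2, hPw, hQw, ← isometry_pow_add_apply, ← isometry_pow_add_apply,
          shift_pow_stdVec, pairing_stdVec, h, zero_add, sub_self])
    simpa [sub_eq_zero] using this
  · change ‖(‖v‖ : ℂ) • P (V x)‖ ≤ _
    rw [norm_smul, Complex.norm_real, norm_norm]
    refine mul_le_mul hvle ((hPle _).trans_eq (V.norm_map x)) (norm_nonneg _) (by positivity)
  · rw [hA0]
    refine (sq_le_sq₀ (norm_nonneg _) (norm_nonneg _)).1 ?_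
    have hre : RCLike.re (inner ℂ (P v) (stdVec 0)) = 1 := by
      rw [← inner_conj_symm, inner_stdVec_left, hv0]
      simp
    rw [norm_sub_sq (𝕜 := ℂ), hre, norm_stdVec]
    have := pow_le_pow_left₀ (norm_nonneg _) (hPle v) 2
    linarith

theorem tendsto_of_tendsto_stdVec_zero {A : ℕ → ellTwo →L[ℂ] ellTwo} {C : ℝ}
    (hA : ∀ k n, A k (stdVec n) = (shift ^ n) (A k (stdVec 0)))
    (hC : ∀ k x, ‖A k x‖ ≤ C * ‖x‖)
    (h : Tendsto (fun k => A k (stdVec 0)) atTop (nhds (stdVec 0))) (x : ellTwo) :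
    Tendsto (fun k => A k x) atTop (nhds x) := by
  have hn : ∀ n, Tendsto (fun k => A k (stdVec n)) atTop (nhds (stdVec n)) := by
    intro n
    have := ((shift ^ n).continuous.tendsto _).comp h
    rw [shift_pow_stdVec, zero_add] at this
    exact this.congr fun k => (hA k n).symm
  have hC0 : 0 ≤ C := by
    have := (norm_nonneg _).trans (hC 0 (stdVec 0))
    rwa [norm_stdVec, mul_one] at this
  rw [Metric.tendsto_atTop]
  intro ε hε
  obtain ⟨s, hs⟩ := ((hasSum_stdVec x).eventually
    (Metric.ball_mem_nhds x (ε := ε / (2 * (C + 1))) (by positivity))).exists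
  set p := ∑ n ∈ s, x n • stdVec n with hp
  have hpt : Tendsto (fun k => A k p) atTop (nhds p) := by
    simp only [hp, map_sum, map_smul]
    exact tendsto_finsetSum _ fun n _ => (hn n).const_smul _
  obtain ⟨N, hN⟩ := Metric.tendsto_atTop.1 hpt (ε / 2) (by positivity)
  refine ⟨N, fun k hk => ?_⟩
  have h1 := hN k hk
  have h2 : ‖x - p‖ < ε / (2 * (C + 1)) := by
    rw [← dist_eq_norm, dist_comm]
    exact hs
  have h3 : ‖A k (x - p)‖ ≤ C * ‖x - p‖ := hC k _
  have h4 : A k x - x = A k (x - p) + (A k p - p) + (p - x) := by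
    rw [map_sub]
    abel
  rw [lt_div_iff₀ (by positivity)] at h2
  rw [dist_eq_norm] at h1 ⊢
  rw [h4]
  have h5 := norm_add₃_le (a := A k (x - p)) (b := A k p - p) (c := p - x)
  rw [norm_sub_rev p x] at h5
  linarith

theorem exists_multiplier_seq (u f g : ellTwo) (h : ∀ m, g m = pairing u ((shift ^ m) f)) :
    ∃ A B : ℕ → ellTwo →L[ℂ] ellTwo, (∀ k n, A k (stdVec n) = (shift ^ n) (A k (stdVec 0))) ∧
      (∀ k n, B k (stdVec n) = (shift ^ n) (B k (stdVec 0))) ∧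
      (∀ k, B k (stdVec 0) = A k f) ∧
      (∀ k x, pairing u (B k x) = pairing g (A k x)) ∧
      ∀ x, Tendsto (fun k => A k x) atTop (nhds x) := by
  have hδ : ∀ k : ℕ, ((1 / ((k : ℝ) + 1) : ℝ) : ℂ) ≠ 0 := fun k => by
    exact_mod_cast (by positivity : (1 / ((k : ℝ) + 1)) ≠ 0)
  have hex := fun k : ℕ => exists_multiplier u (((1 / ((k : ℝ) + 1) : ℝ) : ℂ) • f)
    (((1 / ((k : ℝ) + 1) : ℝ) : ℂ) • g) (fun m => by simp [h])
  choose A B hA hB hBA hpair hbound hclose using hex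
  have hnorm : ∀ k : ℕ, ‖((1 / ((k : ℝ) + 1) : ℝ) : ℂ) • f‖ = 1 / ((k : ℝ) + 1) * ‖f‖ :=
    fun k => by
      rw [norm_smul, Complex.norm_real, Real.norm_of_nonneg (by positivity)]
  refine ⟨A, fun k => (((1 / ((k : ℝ) + 1) : ℝ) : ℂ))⁻¹ • B k, hA, fun k n => ?_, fun k => ?_,
    fun k x => ?_, tendsto_of_tendsto_stdVec_zero hA (C := 1 + ‖f‖) (fun k x => ?_) ?_⟩
  · simp only [smul_apply, map_smul]
    rw [hB]
  · rw [smul_apply, hBA, map_smul, smul_smul, inv_mul_cancel₀ (hδ k), one_smul]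
  · rw [smul_apply, map_smul, hpair, pairing_smul_left, smul_eq_mul, ← mul_assoc,
      inv_mul_cancel₀ (hδ k), one_mul]
  · refine (hbound k x).trans (mul_le_mul_of_nonneg_right ?_ (norm_nonneg _))
    rw [hnorm]
    have : 1 / ((k : ℝ) + 1) ≤ 1 := by
      rw [div_le_one (by positivity)]
      linarith [(Nat.cast_nonneg k : (0 : ℝ) ≤ k)]
    nlinarith [norm_nonneg f]
  · rw [tendsto_iff_norm_sub_tendsto_zero]
    refine squeeze_zero (fun k => norm_nonneg _) hclose ?_
    simp only [hnorm]
    simpa using tendsto_one_div_add_atTop_nhds_zero_nat.mul_const ‖f‖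

theorem multipliers_commute {A B : ellTwo →L[ℂ] ellTwo}
    (hA : ∀ n, A (stdVec n) = (shift ^ n) (A (stdVec 0)))
    (hB : ∀ n, B (stdVec n) = (shift ^ n) (B (stdVec 0))) :
    A (B (stdVec 0)) = B (A (stdVec 0)) := by
  refine lp.ext (funext fun k => ?_)
  rw [apply_eq_sum_antidiagonal hA, apply_eq_sum_antidiagonal hB,
    ← Finset.Nat.sum_antidiagonal_swap]
  exact Finset.sum_congr rfl fun ij _ => mul_comm _ _

/-- The maximal Hankel operator is symmetric for the bilinear pairing. -/
theorem pairing_hankel_symm {u f g b c : ellTwo} (hf : ∀ m, g m = pairing u ((shift ^ m) f))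
    (hb : ∀ m, c m = pairing u ((shift ^ m) b)) : pairing g b = pairing c f := by
  obtain ⟨A, B, -, hB, hBA, hpair, hlim⟩ := exists_multiplier_seq u f g hf
  obtain ⟨A', B', -, hB', hBA', hpair', hlim'⟩ := exists_multiplier_seq u b c hb
  have key : ∀ j k, pairing g (A j (A' k b)) = pairing c (A' k (A j f)) := by
    intro j k
    rw [← hpair, ← hpair', ← hBA, ← hBA', multipliers_commute (hB j) (hB' k)]
  have key' : ∀ k, pairing g (A' k b) = pairing c (A' k f) := by
    intro k
    have h1 := ((pairing g).continuous.tendsto _).comp (hlim (A' k b))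
    have h2 := (((pairing c).comp (A' k)).continuous.tendsto _).comp (hlim f)
    exact tendsto_nhds_unique h1 (h2.congr fun j => (key j k).symm)
  have h1 := ((pairing g).continuous.tendsto _).comp (hlim' b)
  have h2 := ((pairing c).continuous.tendsto _).comp (hlim' f)
  exact tendsto_nhds_unique h1 (h2.congr fun k => (key' k).symm)

theorem eq_hankel_iff (u f g : ellTwo) :
    ⇑g = hankel u f ↔ ∀ m, g m = pairing u ((shift ^ m) f) := by
  simp only [funext_iff, hankel_apply]

/-- The graph of the maximal Hankel operator, as a subspace of the Hilbert space `ℓ² ⊕ ℓ²`. -/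
def hankelGraph (u : ellTwo) : Submodule ℂ (WithLp 2 (ellTwo × ellTwo)) :=
  ⨅ m, LinearMap.ker ((coord m).comp (WithLp.sndL 2 ℂ ellTwo ellTwo) -
    ((pairing u).comp (shift ^ m).toContinuousLinearMap).comp
      (WithLp.fstL 2 ℂ ellTwo ellTwo)).toLinearMap

theorem mem_hankelGraph {u : ellTwo} {x : WithLp 2 (ellTwo × ellTwo)} :
    x ∈ hankelGraph u ↔ ∀ m, x.snd m = pairing u ((shift ^ m) x.fst) := by
  simp [hankelGraph, Submodule.mem_iInf, sub_eq_zero, coord_apply]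

theorem isClosed_hankelGraph (u : ellTwo) :
    IsClosed (hankelGraph u : Set (WithLp 2 (ellTwo × ellTwo))) := by
  rw [hankelGraph, Submodule.coe_iInf]
  exact isClosed_iInter fun m => ContinuousLinearMap.isClosed_ker _

/-- The elements of `ℓ² ⊕ ℓ²` whose first component is finitely supported. -/
def finSuppFst : Submodule ℂ (WithLp 2 (ellTwo × ellTwo)) where
  carrier := {x | FinSupp x.fst}
  zero_mem' := ⟨0, fun _ _ => rfl⟩
  add_mem' := by
    rintro x y ⟨N, hN⟩ ⟨M, hM⟩
    refine ⟨max N M, fun n hn => ?_⟩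
    change x.fst n + y.fst n = 0
    rw [hN n (le_of_max_le_left hn), hM n (le_of_max_le_right hn), add_zero]
  smul_mem' := by
    rintro c x ⟨N, hN⟩
    refine ⟨N, fun n hn => ?_⟩
    change c * x.fst n = 0
    rw [hN n hn, mul_zero]

/-- An element of the graph of the maximal Hankel operator orthogonal to the graph of its
restriction to finitely supported sequences vanishes. -/
theorem eq_zero_of_mem_orthogonal {u : ellTwo} {x : WithLp 2 (ellTwo × ellTwo)}
    (hx : x ∈ hankelGraph u) (hxo : x ∈ (finSuppFst ⊓ hankelGraph u)ᗮ) : x = 0 := by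
  rw [mem_hankelGraph] at hx
  have hadj : ∀ m (k : ℕ), ((shift ^ m).toContinuousLinearMap.adjoint u) k = u (k + m) := by
    intro m k
    rw [← inner_stdVec_left, ContinuousLinearMap.adjoint_inner_right,
      LinearIsometry.coe_toContinuousLinearMap, shift_pow_stdVec, inner_stdVec_left]
  have hstar : ∀ m, (-star x.fst) m = pairing u ((shift ^ m) (star x.snd)) := by
    intro m
    have hmem : WithLp.toLp 2 (stdVec m, (shift ^ m).toContinuousLinearMap.adjoint u) ∈
        finSuppFst ⊓ hankelGraph u := by
      refine ⟨⟨m + 1, fun n hn => ?_⟩, mem_hankelGraph.2 fun k => ?_⟩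
      · exact (stdVec_apply m n).trans (if_neg (by omega))
      · change ((shift ^ m).toContinuousLinearMap.adjoint u) k = pairing u ((shift ^ k) (stdVec m))
        rw [hadj, shift_pow_stdVec, pairing_stdVec, add_comm]
    have h := (Submodule.mem_orthogonal' _ _).1 hxo _ hmem
    rw [WithLp.prod_inner_apply] at h
    change inner ℂ x.fst (stdVec m) +
      inner ℂ x.snd ((shift ^ m).toContinuousLinearMap.adjoint u) = 0 at h
    rw [ContinuousLinearMap.adjoint_inner_right, ← inner_conj_symm x.fst, inner_stdVec_left,
      LinearIsometry.coe_toContinuousLinearMap] at h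
    have hs : star ((shift ^ m) x.snd) = (shift ^ m) (star x.snd) := by
      refine lp.ext (funext fun k => ?_)
      rw [lp.coeFn_star, Pi.star_apply, shift_pow_apply, shift_pow_apply, lp.coeFn_star,
        Pi.star_apply]
      split_ifs <;> simp
    rw [pairing_comm, ← hs, pairing, star_star, innerSL_apply_apply, lp.coeFn_neg, Pi.neg_apply,
      lp.coeFn_star, Pi.star_apply]
    exact neg_eq_of_add_eq_zero_right h
  have h := pairing_hankel_symm hx hstar
  rw [pairing_comm, pairing, star_star, ← neg_one_smul ℂ, pairing_smul_left, pairing, star_star,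
    innerSL_apply_apply, innerSL_apply_apply, inner_self_eq_norm_sq_to_K,
    inner_self_eq_norm_sq_to_K] at h
  have h' : ‖x.snd‖ ^ 2 = -1 * ‖x.fst‖ ^ 2 := by
    apply Complex.ofReal_injective
    push_cast
    exact h
  have hn := WithLp.prod_norm_sq_eq_of_L2 x
  rw [h'] at hn
  exact norm_eq_zero.1 (pow_eq_zero_iff two_ne_zero |>.1 (by linarith))

theorem hankelGraph_eq_topologicalClosure (u : ellTwo) :
    hankelGraph u = (finSuppFst ⊓ hankelGraph u).topologicalClosure := by
  set K := (finSuppFst ⊓ hankelGraph u).topologicalClosure with hK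
  have hle : K ≤ hankelGraph u :=
    Submodule.topologicalClosure_minimal _ inf_le_right (isClosed_hankelGraph u)
  have : CompleteSpace K := (Submodule.isClosed_topologicalClosure _).completeSpace_coe
  refine le_antisymm (fun x hx => ?_) hle
  have hP := K.starProjection_apply_mem x
  have h0 := eq_zero_of_mem_orthogonal ((hankelGraph u).sub_mem hx (hle hP))
    (Submodule.orthogonal_le (Submodule.le_topologicalClosure _)
      (K.sub_starProjection_mem_orthogonal x))
  rwa [← sub_eq_zero.1 h0] at hP

/-- The maximal Hankel operator `Γ_u` coincides with the closure of its restriction to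
finitely supported sequences: its graph in `ℓ² × ℓ²` equals the closure of the graph of the
restriction to finitely supported sequences. -/
theorem stmt_0 (u : ellTwo) :
    {fg : ellTwo × ellTwo | ⇑fg.2 = hankel (⇑u) (⇑fg.1)} =
      closure {fg : ellTwo × ellTwo | FinSupp (⇑fg.1) ∧ ⇑fg.2 = hankel (⇑u) (⇑fg.1)} := by
  have h := congrArg (fun K : Submodule ℂ (WithLp 2 (ellTwo × ellTwo)) =>
    (WithLp.prodContinuousLinearEquiv 2 ℂ ellTwo ellTwo).symm ⁻¹' (K : Set _))
    (hankelGraph_eq_topologicalClosure u)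
  simp only [Submodule.topologicalClosure_coe] at h
  rw [(WithLp.prodContinuousLinearEquiv 2 ℂ ellTwo ellTwo).symm.preimage_closure] at h
  convert! h using 1
  · ext x
    exact (eq_hankel_iff u x.1 x.2).trans mem_hankelGraph.symm
  · congr 1
    ext x
    exact and_congr Iff.rfl ((eq_hankel_iff u x.1 x.2).trans mem_hankelGraph.symm)
end
end

section
/- Let u ∈ ℓ²(ℕ, ℂ) be such that u(n) ∈ ℝ for every n. Then the Hankel operator Γ_u restricted to finitely supported sequences is essentially self-adjoint: its closure is a self-adjoint operator, and this closure equals the maximal Hankel operator Γ_u, which satisfies Γ_u* = Γ_u (that is, for f, h ∈ ℓ², ⟨Γ_u g, f⟩ = ⟨g, h⟩ holds for all g ∈ Dom Γ_u if and only if f ∈ Dom Γ_u and Γ_u f = h). -/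
open scoped ComplexConjugate
open Filter

noncomputable section

/-- The `ℓ²` inner product, linear in the first argument. -/
def ip (f g : ℕ → ℂ) : ℂ := ∑' n : ℕ, f n * conj (g n)

open Topology

local notation "⟪" x "," y "⟫" => inner ℂ x y

namespace Hankel

/-- The standard basis vectors of `ℓ²`. -/
def e (i : ℕ) : ellTwo := lp.single 2 i (1 : ℂ)

lemma e_apply (i m : ℕ) : (e i) m = if m = i then 1 else 0 := by
  simp [e, lp.single_apply, Pi.single_apply]

lemma inner_e_left (i : ℕ) (f : ellTwo) : ⟪e i, f⟫ = f i := by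
  rw [e, lp.inner_single_left]; simp

lemma inner_e_right (i : ℕ) (f : ellTwo) : ⟪f, e i⟫ = conj (f i) := by
  rw [← inner_conj_symm, inner_e_left]

lemma hasSum_e (f : ellTwo) : HasSum (fun i => f i • e i) f := by
  have h := lp.hasSum_single (p := 2) (by simp) f
  simpa [e, ← lp.single_smul] using h

lemma orthonormal_e : Orthonormal ℂ e := by
  rw [orthonormal_iff_ite]
  intro i j
  rw [inner_e_left, e_apply]

lemma clm_ext_e {F : Type*} [NormedAddCommGroup F] [NormedSpace ℂ F] {A B : ellTwo →L[ℂ] F}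
    (h : ∀ i, A (e i) = B (e i)) : A = B := by
  ext1 f
  have hA := (hasSum_e f).mapL A
  have hB := (hasSum_e f).mapL B
  simp only [map_smul, h] at hA hB
  exact hA.unique hB

/-- The isometry sending the standard basis of `ℓ²` to a given orthonormal sequence. -/
def isometryOfOrthonormal {F : Type*} [NormedAddCommGroup F] [InnerProductSpace ℂ F]
    [CompleteSpace F] {x : ℕ → F} (hx : Orthonormal ℂ x) : ellTwo →ₗᵢ[ℂ] F :=
  hx.orthogonalFamily.linearIsometry

lemma isometryOfOrthonormal_e {F : Type*} [NormedAddCommGroup F] [InnerProductSpace ℂ F]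
    [CompleteSpace F] {x : ℕ → F} (hx : Orthonormal ℂ x) (i : ℕ) :
    isometryOfOrthonormal hx (e i) = x i := by
  simp [isometryOfOrthonormal, e]

/-- The `n`-fold unilateral shift. -/
def S (n : ℕ) : ellTwo →ₗᵢ[ℂ] ellTwo :=
  isometryOfOrthonormal (orthonormal_e.comp (fun i => i + n) (add_left_injective n))

lemma S_e (n i : ℕ) : S n (e i) = e (i + n) := isometryOfOrthonormal_e _ i

lemma hasSum_S (n : ℕ) (f : ellTwo) : HasSum (fun i => f i • e (i + n)) (S n f) := by
  have h := (hasSum_e f).mapL (S n).toContinuousLinearMap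
  simpa [S_e] using h

lemma S_S (m n : ℕ) (f : ellTwo) : S m (S n f) = S (m + n) f := by
  have : (S m).toContinuousLinearMap ∘L (S n).toContinuousLinearMap
      = (S (m + n)).toContinuousLinearMap := by
    apply clm_ext_e
    intro i
    simp [S_e, add_comm, add_left_comm]
  exact DFunLike.congr_fun this f

lemma S_zero (f : ellTwo) : S 0 f = f := by
  have : (S 0).toContinuousLinearMap = ContinuousLinearMap.id ℂ ellTwo := by
    apply clm_ext_e
    intro i
    simp [S_e]
  exact DFunLike.congr_fun this f

lemma hasSum_inner_S (n : ℕ) (v f : ellTwo) :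
    HasSum (fun i => conj (v (i + n)) * f i) ⟪v, S n f⟫ := by
  have h := (hasSum_S n f).mapL (innerSL ℂ v)
  simpa [inner_smul_right, inner_e_right, mul_comm] using h

lemma S_apply (n : ℕ) (f : ellTwo) (m : ℕ) : (S n f) m = if n ≤ m then f (m - n) else 0 := by
  have h := hasSum_inner_S n (e m) f
  rw [inner_e_left] at h
  refine h.unique ?_
  split_ifs with hnm
  · convert hasSum_single (m - n) ?_ using 1
    · simp [e_apply, Nat.sub_add_cancel hnm]
    · intro i hi
      have : i + n ≠ m := by omega
      simp [e_apply, this]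
  · convert hasSum_zero using 2 with i
    have : i + n ≠ m := by omega
    simp [e_apply, this]

/-- An operator commuting with the shift, i.e. a multiplier. -/
def Commutes (A : ellTwo →L[ℂ] ellTwo) : Prop := ∀ i, A (e i) = S i (A (e 0))

lemma Commutes.apply_S {A : ellTwo →L[ℂ] ellTwo} (hA : Commutes A) (n : ℕ) (f : ellTwo) :
    A (S n f) = S n (A f) := by
  have : A ∘L (S n).toContinuousLinearMap = (S n).toContinuousLinearMap ∘L A := by
    apply clm_ext_e
    intro i
    simp [S_e, hA i, hA (n + i), S_S, add_comm]
  exact DFunLike.congr_fun this f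

/-- A bounded net of operators converging to zero on the basis converges to zero strongly. -/
lemma tendsto_zero_of_basis {ι F : Type*} [NormedAddCommGroup F] [NormedSpace ℂ F] {l : Filter ι}
    (T : ι → ellTwo →L[ℂ] F) {C : ℝ} (hC : ∀ i, ‖T i‖ ≤ C)
    (h : ∀ j, Tendsto (fun i => T i (e j)) l (𝓝 0)) (f : ellTwo) :
    Tendsto (fun i => T i f) l (𝓝 0) := by
  rw [Metric.tendsto_nhds]
  intro ε hε
  rcases isEmpty_or_nonempty ι with hι | ⟨⟨i₀⟩⟩
  · exact Eventually.of_forall fun i => hι.elim i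
  have hC0 : 0 ≤ C := (norm_nonneg _).trans (hC i₀)
  have hf := (hasSum_e f)
  rw [HasSum, Metric.tendsto_nhds] at hf
  obtain ⟨s, hs⟩ := (hf (ε / (2 * (C + 1))) (by positivity)).exists
  have h1 : Tendsto (fun i => T i (∑ j ∈ s, f j • e j)) l (𝓝 0) := by
    simp only [map_sum, map_smul]
    have := tendsto_finsetSum s (fun j _ => (h j).const_smul (f j))
    simpa using this
  rw [Metric.tendsto_nhds] at h1
  filter_upwards [h1 (ε / 2) (by positivity)] with i hi
  rw [dist_zero_right] at hi ⊢
  rw [dist_comm, dist_eq_norm] at hs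
  have h2 : ‖T i (f - ∑ j ∈ s, f j • e j)‖ ≤ C * (ε / (2 * (C + 1))) :=
    (T i).le_of_opNorm_le_of_le (hC i) hs.le
  have h3 : C * (ε / (2 * (C + 1))) ≤ ε / 2 := by
    rw [mul_div_assoc', div_le_div_iff₀ (by positivity) (by positivity)]
    nlinarith
  have h4 : T i f = T i (f - ∑ j ∈ s, f j • e j) + T i (∑ j ∈ s, f j • e j) := by
    rw [← map_add, sub_add_cancel]
  rw [h4]
  linarith [norm_add_le (T i (f - ∑ j ∈ s, f j • e j)) (T i (∑ j ∈ s, f j • e j))]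

lemma tendsto_inner_of_basis {T : ℕ → ellTwo →L[ℂ] ellTwo} {A : ellTwo →L[ℂ] ellTwo} {C : ℝ}
    (hC : ∀ i, ‖T i‖ ≤ C)
    (h : ∀ j m, Tendsto (fun i => (T i (e j)) m) atTop (𝓝 ((A (e j)) m))) (v f : ellTwo) :
    Tendsto (fun i => ⟪v, T i f⟫) atTop (𝓝 ⟪v, A f⟫) := by
  have hC' : ∀ i, ‖T i - A‖ ≤ C + ‖A‖ := fun i =>
    (norm_sub_le _ _).trans (by gcongr; exact hC i)
  have key : ∀ j, Tendsto (fun i => ⟪v, (T i - A) (e j)⟫) atTop (𝓝 0) := by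
    intro j
    have hb : ∀ i, ‖innerSL ℂ ((T i - A) (e j))‖ ≤ C + ‖A‖ := by
      intro i
      rw [innerSL_apply_norm]
      have := (T i - A).le_of_opNorm_le (hC' i) (e j)
      rwa [orthonormal_e.1 j, mul_one] at this
    have := tendsto_zero_of_basis (l := atTop) (fun i => innerSL ℂ ((T i - A) (e j))) hb (fun m => by
      simp only [innerSL_apply_apply, inner_e_right]
      have := ((h j m).sub_const ((A (e j)) m))
      rw [sub_self] at this
      simpa [Function.comp_def] using! (Complex.continuous_conj.tendsto 0).comp this) v
    have h2 := (Complex.continuous_conj.tendsto 0).comp this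
    simpa [Function.comp_def, inner_conj_symm] using! h2
  have := tendsto_zero_of_basis (l := atTop) (fun i => (innerSL ℂ v) ∘L (T i - A))
    (C := ‖v‖ * (C + ‖A‖)) (fun i => by
      refine (ContinuousLinearMap.opNorm_comp_le _ _).trans ?_
      rw [innerSL_apply_norm]
      gcongr
      exact hC' i) (fun j => by simpa using key j) f
  rw [← tendsto_sub_nhds_zero_iff]
  simpa [inner_sub_right] using this

/-- The Cesàro means of the multiplier with symbol `a`, scaled by `N`. -/
def cesaro (a : ellTwo) (N : ℕ) : ellTwo →L[ℂ] ellTwo :=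
  ∑ n ∈ Finset.range N, (((N - n : ℕ) : ℂ) * a n) • (S n).toContinuousLinearMap

lemma cesaro_apply (a : ellTwo) (N : ℕ) (f : ellTwo) :
    cesaro a N f = ∑ n ∈ Finset.range N, (((N - n : ℕ) : ℂ) * a n) • S n f := by
  simp [cesaro]

lemma cesaro_e_apply (a : ellTwo) (N i m : ℕ) :
    (cesaro a N (e i)) m = if i ≤ m then ((N - (m - i) : ℕ) : ℂ) * a (m - i) else 0 := by
  rw [← inner_e_left, cesaro_apply, inner_sum]
  simp only [inner_smul_right, S_e, inner_e_left, e_apply]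
  split_ifs with him
  · by_cases hN : m - i < N
    · rw [Finset.sum_eq_single_of_mem (m - i) (Finset.mem_range.2 hN)]
      · simp [Nat.add_sub_cancel' him]
      · intro n _ hn
        have : m ≠ i + n := by omega
        simp [this]
    · rw [Finset.sum_eq_zero]
      · simp [Nat.sub_eq_zero_of_le (not_lt.1 hN)]
      · intro n hn
        have : m ≠ i + n := by have := Finset.mem_range.1 hn; omega
        simp [this]
  · refine Finset.sum_eq_zero fun n _ => ?_
    have : m ≠ i + n := by omega
    simp [this]

/-- The finite vector with coordinates `p i`, for `i < M` in the window `t - N < i ≤ t`. -/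
def window (p : ℕ → ℂ) (M N t : ℕ) : ellTwo :=
  ∑ i ∈ Finset.range M, (if t ∈ Finset.Ico i (i + N) then p i else 0) • e i

lemma norm_sq_sum_e (s : Finset ℕ) (p : ℕ → ℂ) :
    ‖∑ i ∈ s, p i • e i‖ ^ 2 = ∑ i ∈ s, ‖p i‖ ^ 2 := by
  have h := orthonormal_e.inner_sum p p s
  rw [inner_self_eq_norm_sq_to_K] at h
  simp only [RCLike.conj_mul] at h
  exact_mod_cast h

lemma sum_window (p : ℕ → ℂ) (M N : ℕ) :
    ∑ t ∈ Finset.range (M + N), ‖window p M N t‖ ^ 2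
      = N * ‖∑ i ∈ Finset.range M, p i • e i‖ ^ 2 := by
  simp only [window, norm_sq_sum_e]
  rw [Finset.sum_comm, Finset.mul_sum]
  refine Finset.sum_congr rfl fun i hi => ?_
  have hi := Finset.mem_range.1 hi
  have h : ∀ t, ‖if t ∈ Finset.Ico i (i + N) then p i else 0‖ ^ 2
      = if t ∈ Finset.Ico i (i + N) then ‖p i‖ ^ 2 else 0 := by
    intro t; split_ifs <;> simp
  simp only [h]
  rw [← Finset.sum_filter, Finset.sum_const, nsmul_eq_mul]
  congr 2
  have : (Finset.range (M + N)).filter (· ∈ Finset.Ico i (i + N)) = Finset.Ico i (i + N) := by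
    ext t; simp only [Finset.mem_filter, Finset.mem_range, Finset.mem_Ico]; omega
  rw [this]; simp

lemma inner_cesaro_eq {A : ellTwo →L[ℂ] ellTwo} (hA : Commutes A) (p q : ℕ → ℂ) (M N : ℕ) :
    ⟪∑ m ∈ Finset.range M, q m • e m, cesaro (A (e 0)) N (∑ i ∈ Finset.range M, p i • e i)⟫
      = ∑ t ∈ Finset.range (M + N), ⟪window q M N t, A (window p M N t)⟫ := by
  simp only [window, map_sum, map_smul, sum_inner, inner_sum, inner_smul_left, inner_smul_right,
    inner_e_left, Finset.mul_sum]
  conv_rhs => rw [Finset.sum_comm]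
  refine Finset.sum_congr rfl fun i hi => ?_
  conv_rhs => rw [Finset.sum_comm]
  refine Finset.sum_congr rfl fun m hm => ?_
  have hi := Finset.mem_range.1 hi
  have hm := Finset.mem_range.1 hm
  have h : ∀ t, (if t ∈ Finset.Ico i (i + N) then p i else 0) *
      (conj (if t ∈ Finset.Ico m (m + N) then q m else 0) * (A (e i)) m)
      = if t ∈ Finset.Ico m (m + N) ∩ Finset.Ico i (i + N)
        then p i * (conj (q m) * (A (e i)) m) else 0 := by
    intro t
    by_cases h1 : t ∈ Finset.Ico m (m + N) <;> by_cases h2 : t ∈ Finset.Ico i (i + N) <;>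
      simp only [h1, h2, Finset.mem_inter] <;> simp
  simp only [h]
  rw [← Finset.sum_filter, Finset.sum_const, nsmul_eq_mul, cesaro_e_apply, hA i, S_apply]
  split_ifs with him
  · have : (Finset.range (M + N)).filter (· ∈ Finset.Ico m (m + N) ∩ Finset.Ico i (i + N))
        = Finset.Ico m (i + N) := by
      ext t; simp only [Finset.mem_filter, Finset.mem_range, Finset.mem_inter, Finset.mem_Ico]
      omega
    rw [this, Nat.card_Ico, show i + N - m = N - (m - i) by omega]
    ring
  · simp

lemma norm_inner_cesaro_le {A : ellTwo →L[ℂ] ellTwo} (hA : Commutes A) (p q : ℕ → ℂ) (M N : ℕ) :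
    ‖⟪∑ m ∈ Finset.range M, q m • e m, cesaro (A (e 0)) N (∑ i ∈ Finset.range M, p i • e i)⟫‖
      ≤ N * ‖A‖ * ‖∑ i ∈ Finset.range M, p i • e i‖ * ‖∑ m ∈ Finset.range M, q m • e m‖ := by
  rw [inner_cesaro_eq hA]
  calc _ ≤ ∑ t ∈ Finset.range (M + N), ‖A‖ * (‖window q M N t‖ * ‖window p M N t‖) := by
        refine norm_sum_le_of_le _ fun t _ => (norm_inner_le_norm _ _).trans ?_
        have := A.le_opNorm (window p M N t)
        calc _ ≤ ‖window q M N t‖ * (‖A‖ * ‖window p M N t‖) := by gcongr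
          _ = _ := by ring
    _ ≤ ‖A‖ * (√(∑ t ∈ Finset.range (M + N), ‖window q M N t‖ ^ 2) *
          √(∑ t ∈ Finset.range (M + N), ‖window p M N t‖ ^ 2)) := by
        rw [← Finset.mul_sum]
        gcongr
        exact Real.sum_mul_le_sqrt_mul_sqrt _ _ _
    _ = _ := by
        rw [sum_window, sum_window, Real.sqrt_mul (by positivity), Real.sqrt_mul (by positivity),
          Real.sqrt_sq (by positivity), Real.sqrt_sq (by positivity)]
        have : √(N : ℝ) * √(N : ℝ) = N := Real.mul_self_sqrt (by positivity)
        linear_combination (‖A‖ * ‖∑ i ∈ Finset.range M, p i • e i‖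
          * ‖∑ m ∈ Finset.range M, q m • e m‖) * this

lemma norm_cesaro_le {A : ellTwo →L[ℂ] ellTwo} (hA : Commutes A) (N : ℕ) :
    ‖cesaro (A (e 0)) N‖ ≤ N * ‖A‖ := by
  have h : ∀ v f : ellTwo, ‖⟪v, cesaro (A (e 0)) N f⟫‖ ≤ N * ‖A‖ * ‖f‖ * ‖v‖ := by
    intro v f
    have hv := (hasSum_e v).tendsto_sum_nat
    have hf := (hasSum_e f).tendsto_sum_nat
    exact le_of_tendsto_of_tendsto'
      (hv.inner (((cesaro (A (e 0)) N).continuous.tendsto f).comp hf)).norm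
      ((hf.norm.const_mul _).mul hv.norm) fun M => norm_inner_cesaro_le hA _ _ M N
  refine ContinuousLinearMap.opNorm_le_bound _ (by positivity) fun f => ?_
  rcases (norm_nonneg (cesaro (A (e 0)) N f)).eq_or_lt with h0 | h0
  · rw [← h0]; positivity
  · have := h (cesaro (A (e 0)) N f) f
    rw [inner_self_eq_norm_sq_to_K, norm_pow, RCLike.norm_ofReal, abs_norm, sq] at this
    exact le_of_mul_le_mul_right this h0

lemma norm_inv_smul_cesaro_le {A : ellTwo →L[ℂ] ellTwo} (hA : Commutes A) (N : ℕ) :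
    ‖(N : ℂ)⁻¹ • cesaro (A (e 0)) N‖ ≤ ‖A‖ := by
  rcases N.eq_zero_or_pos with rfl | hN
  · simp
  rw [norm_smul, norm_inv, Complex.norm_natCast, inv_mul_le_iff₀ (by positivity)]
  exact norm_cesaro_le hA N

lemma tendsto_cesaro_e {A : ellTwo →L[ℂ] ellTwo} (hA : Commutes A) (i m : ℕ) :
    Tendsto (fun N : ℕ => (((N : ℂ)⁻¹ • cesaro (A (e 0)) N) (e i)) m) atTop (𝓝 ((A (e i)) m)) := by
  simp only [smul_apply, lp.coeFn_smul, Pi.smul_apply, smul_eq_mul,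
    cesaro_e_apply]
  rw [hA i, S_apply]
  split_ifs with him
  · have h1 : Tendsto (fun N : ℕ => (1 - ((m - i : ℕ) : ℂ) * (N : ℂ)⁻¹) * (A (e 0)) (m - i)) atTop
        (𝓝 ((A (e 0)) (m - i))) := by
      have := ((tendsto_inv_atTop_nhds_zero_nat (𝕜 := ℂ)).const_mul ((m - i : ℕ) : ℂ)).const_sub 1
      simpa using this.mul_const ((A (e 0)) (m - i))
    refine h1.congr' ?_
    filter_upwards [eventually_ge_atTop (m - i + 1)] with N hN
    have : (N : ℂ) ≠ 0 := by norm_cast; omega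
    rw [Nat.cast_sub (by omega : m - i ≤ N)]
    field_simp
  · simp

/-- Interchange of the action of a multiplier with the inner product. -/
lemma inner_multiplier {A : ellTwo →L[ℂ] ellTwo} (hA : Commutes A) {v f w : ellTwo}
    (hw : ∀ n, w n = ⟪v, S n f⟫) : ⟪v, A f⟫ = ⟪star w, A (e 0)⟫ := by
  have h1 := tendsto_inner_of_basis (norm_inv_smul_cesaro_le hA) (tendsto_cesaro_e hA) v f
  have h2 := tendsto_inner_of_basis (norm_inv_smul_cesaro_le hA) (tendsto_cesaro_e hA)
    (star w) (e 0)
  refine tendsto_nhds_unique h1 (h2.congr fun N => ?_)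
  simp [cesaro_apply, S_e, inner_e_right, hw]

lemma multiplier_apply {A : ellTwo →L[ℂ] ellTwo} (hA : Commutes A) (f : ellTwo) (m : ℕ) :
    (A f) m = ∑ i ∈ Finset.range (m + 1), f i * (S i (A (e 0))) m := by
  have h := ((hasSum_e f).mapL A).mapL (innerSL ℂ (e m))
  have h' : HasSum (fun i => f i * (S i (A (e 0))) m) ((A f) m) := by
    simpa only [← hA _, map_smul, innerSL_apply_apply, inner_e_left, smul_eq_mul] using h
  refine h'.unique (hasSum_sum_of_ne_finset_zero fun i hi => ?_)
  rw [S_apply, if_neg (by simpa using hi), mul_zero]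

/-- The graph of multiplication by `f`, restricted to the functions vanishing at the origin. -/
def mulGraph (f : ellTwo) : Submodule ℂ (WithLp 2 (ellTwo × ellTwo)) where
  carrier := {x | x.fst 0 = 0 ∧
    ∀ m, x.snd m = ∑ i ∈ Finset.range (m + 1), f i * (S i x.fst) m}
  zero_mem' := by simp
  add_mem' := by
    rintro x y ⟨hx0, hx⟩ ⟨hy0, hy⟩
    refine ⟨by simp [hx0, hy0], fun m => ?_⟩
    simp [hx m, hy m, mul_add, Finset.sum_add_distrib]
  smul_mem' := by
    rintro c x ⟨hx0, hx⟩
    refine ⟨by simp [hx0], fun m => ?_⟩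
    simp [hx m, Finset.mul_sum, mul_left_comm]

lemma isClosed_mulGraph (f : ellTwo) :
    IsClosed (mulGraph f : Set (WithLp 2 (ellTwo × ellTwo))) := by
  have hev : ∀ m, Continuous fun x : ellTwo => x m := fun m =>
    (innerSL ℂ (e m)).continuous.congr fun x => inner_e_left m x
  have hfst : Continuous fun x : WithLp 2 (ellTwo × ellTwo) => x.fst :=
    (WithLp.fstL 2 ℂ ellTwo ellTwo).continuous
  have hsnd : Continuous fun x : WithLp 2 (ellTwo × ellTwo) => x.snd :=
    (WithLp.sndL 2 ℂ ellTwo ellTwo).continuous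
  have hmul : IsClosed {x : WithLp 2 (ellTwo × ellTwo) |
      ∀ m, x.snd m = ∑ i ∈ Finset.range (m + 1), f i * (S i x.fst) m} := by
    simp only [Set.ofPred_forall]
    exact isClosed_iInter fun m => isClosed_eq ((hev m).comp hsnd)
      (continuous_finsetSum _ fun i _ =>
        continuous_const.mul ((hev m).comp ((S i).continuous.comp hfst)))
  exact (isClosed_eq ((hev 0).comp hfst) continuous_const).inter hmul

/-- Every `f ∈ H²` is a quotient of two bounded multipliers `A` and `B`, with `A` close to the
identity when `f` is small. -/
lemma exists_multipliers (f : ellTwo) : ∃ A B : ellTwo →L[ℂ] ellTwo, Commutes A ∧ Commutes B ∧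
    B (e 0) = A f ∧ ‖A‖ ≤ √(1 + ‖f‖ ^ 2) ∧ ‖A (e 0) - e 0‖ ≤ ‖f‖ := by
  have : CompleteSpace (mulGraph f) := (isClosed_mulGraph f).completeSpace_coe
  set x : WithLp 2 (ellTwo × ellTwo) := WithLp.toLp 2 (e 0, f) with hx
  set w := x - (mulGraph f).starProjection x with hw
  have hpx : (mulGraph f).starProjection x ∈ mulGraph f := Submodule.starProjection_apply_mem _ _
  have hort : w ∈ (mulGraph f)ᗮ := Submodule.sub_starProjection_mem_orthogonal x
  have hw0 : w.fst 0 = 1 := by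
    rw [hw, WithLp.sub_fst, lp.coeFn_sub, Pi.sub_apply, hpx.1]
    simp [hx, e_apply]
  have hwm : ∀ m, w.snd m = ∑ i ∈ Finset.range (m + 1), f i * (S i w.fst) m := by
    intro m
    have hxm : x.snd m = ∑ i ∈ Finset.range (m + 1), f i * (S i x.fst) m := by
      simp [hx, S_e, e_apply]
    simp [hw, hxm, hpx.2 m, mul_sub, Finset.sum_sub_distrib]
  let R : ℕ → WithLp 2 (ellTwo × ellTwo) →ₗᵢ[ℂ] WithLp 2 (ellTwo × ellTwo) :=
    fun n => (S n).withLpProdMap 2 (S n)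
  have hR1 : ∀ n y, (R n y).fst = S n y.fst := fun n y => rfl
  have hR2 : ∀ n y, (R n y).snd = S n y.snd := fun n y => rfl
  have hRmem : ∀ n, R (n + 1) w ∈ mulGraph f := by
    intro n
    refine ⟨by simp [hR1, S_apply], fun m => ?_⟩
    rw [hR1, hR2, S_apply]
    simp only [S_S]
    split_ifs with h
    · rw [hwm]
      refine Finset.sum_subset_zero_on_sdiff (Finset.range_subset_range.2 (by omega)) ?_ ?_
      · intro i hi
        simp only [Finset.mem_sdiff, Finset.mem_range] at hi
        rw [S_apply, if_neg (by omega), mul_zero]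
      · intro i hi
        have hi := Finset.mem_range.1 hi
        rw [S_apply, S_apply, if_pos (by omega), if_pos (by omega),
          show m - (n + 1) - i = m - (i + (n + 1)) by omega]
    · refine (Finset.sum_eq_zero fun i _ => ?_).symm
      rw [S_apply, if_neg (by omega), mul_zero]
  have hRR : ∀ m n y, R (m + n) y = R m (R n y) := by
    intro m n y
    refine WithLp.ofLp_injective 2 (Prod.ext ?_ ?_)
    · exact (S_S m n y.fst).symm
    · exact (S_S m n y.snd).symm
  have hwne : w ≠ 0 := by
    intro h
    simp [h] at hw0
  have hon : Orthonormal ℂ fun n => ((‖w‖ : ℂ)⁻¹) • R n w := by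
    have hlt : ∀ m n, m < n → ⟪R m w, R n w⟫ = 0 := by
      intro m n hmn
      obtain ⟨k, rfl⟩ := Nat.exists_eq_add_of_lt hmn
      rw [add_assoc, hRR, LinearIsometry.inner_map_map]
      exact (Submodule.mem_orthogonal' _ _).1 hort _ (hRmem k)
    refine ⟨fun n => ?_, fun m n hmn => ?_⟩
    · rw [norm_smul, LinearIsometry.norm_map, norm_inv, Complex.norm_real, norm_norm,
        inv_mul_cancel₀ (norm_ne_zero_iff.2 hwne)]
    · dsimp only
      rw [inner_smul_left, inner_smul_right]
      rcases hmn.lt_or_gt with h | h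
      · rw [hlt m n h]; simp
      · rw [← inner_conj_symm, hlt n m h]; simp
  let W := isometryOfOrthonormal hon
  have hW : ∀ i, (‖w‖ : ℂ) • W (e i) = R i w := by
    intro i
    rw [isometryOfOrthonormal_e, smul_smul, mul_inv_cancel₀, one_smul]
    exact_mod_cast norm_ne_zero_iff.2 hwne
  let A : ellTwo →L[ℂ] ellTwo :=
    (‖w‖ : ℂ) • (WithLp.fstL 2 ℂ ellTwo ellTwo ∘L W.toContinuousLinearMap)
  let B : ellTwo →L[ℂ] ellTwo :=
    (‖w‖ : ℂ) • (WithLp.sndL 2 ℂ ellTwo ellTwo ∘L W.toContinuousLinearMap)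
  have hA : ∀ i, A (e i) = S i w.fst := fun i => congrArg WithLp.fst (hW i)
  have hB : ∀ i, B (e i) = S i w.snd := fun i => congrArg WithLp.snd (hW i)
  have hAc : Commutes A := fun i => by rw [hA, hA, S_zero]
  have hBc : Commutes B := fun i => by rw [hB, hB, S_zero]
  have hwx : ‖w‖ ≤ √(1 + ‖f‖ ^ 2) := by
    have h1 : ‖x‖ ^ 2 = 1 + ‖f‖ ^ 2 := by
      rw [WithLp.prod_norm_sq_eq_of_L2, hx]
      simp [orthonormal_e.1 0]
    rw [← h1, Real.sqrt_sq (norm_nonneg _)]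
    have h2 := norm_add_sq_eq_norm_sq_add_norm_sq_of_inner_eq_zero (𝕜 := ℂ) _ _
      ((Submodule.mem_orthogonal' _ _).1 hort _ hpx)
    rw [hw, sub_add_cancel, ← hw] at h2
    refine (sq_le_sq₀ (norm_nonneg _) (norm_nonneg _)).1 ?_
    nlinarith [mul_self_nonneg ‖(mulGraph f).starProjection x‖]
  refine ⟨A, B, hAc, hBc, ?_, ?_, ?_⟩
  · ext m
    rw [multiplier_apply hAc, hA, hB, S_zero, S_zero, hwm]
  · refine (ContinuousLinearMap.opNorm_le_bound _ (norm_nonneg w) fun g => ?_).trans hwx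
    change ‖(‖w‖ : ℂ) • (W g).fst‖ ≤ _
    rw [norm_smul, Complex.norm_real, norm_norm]
    gcongr
    exact (WithLp.norm_fst_le _ _).trans_eq (W.norm_map g)
  · rw [hA, S_zero]
    have h1 : ‖w.fst‖ ^ 2 ≤ 1 + ‖f‖ ^ 2 := by
      rw [← Real.sq_sqrt (by positivity : 0 ≤ 1 + ‖f‖ ^ 2)]
      gcongr
      exact (WithLp.norm_fst_le _ w).trans hwx
    have h2 := norm_sub_sq (𝕜 := ℂ) w.fst (e 0)
    rw [inner_e_right, hw0, orthonormal_e.1 0] at h2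
    simp at h2
    exact (sq_le_sq₀ (norm_nonneg _) (norm_nonneg _)).1 (by linarith)

/-- The `n`-fold backward shift. -/
def T (n : ℕ) : ellTwo →L[ℂ] ellTwo := ContinuousLinearMap.adjoint (S n).toContinuousLinearMap

lemma inner_T_left (n : ℕ) (x y : ellTwo) : ⟪T n x, y⟫ = ⟪x, S n y⟫ :=
  ContinuousLinearMap.adjoint_inner_left _ _ _

lemma inner_T_right (n : ℕ) (x y : ellTwo) : ⟪x, T n y⟫ = ⟪S n x, y⟫ :=
  ContinuousLinearMap.adjoint_inner_right _ _ _

lemma T_apply (n : ℕ) (x : ellTwo) (m : ℕ) : (T n x) m = x (m + n) := by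
  rw [← inner_e_left, inner_T_right, S_e, inner_e_left]

lemma inner_star_star (x y : ellTwo) : ⟪star x, star y⟫ = ⟪y, x⟫ := by
  simp [lp.inner_eq_tsum, mul_comm]

lemma inner_multiplier_symm {A B : ellTwo →L[ℂ] ellTwo} (hA : Commutes A) (hB : Commutes B)
    {v f g k l : ellTwo} (hBA : B (e 0) = A f) (hk : ∀ n, k n = ⟪v, S n f⟫)
    (hl : ∀ n, l n = ⟪v, S n g⟫) : ⟪star l, A f⟫ = ⟪star k, A g⟫ := by
  rw [← hBA, ← inner_multiplier hB hl]
  have h1 := ((hasSum_e g).mapL B).mapL (innerSL ℂ v)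
  have h2 := ((hasSum_e g).mapL A).mapL (innerSL ℂ (star k))
  simp only [map_smul, innerSL_apply_apply] at h1 h2
  refine h1.unique ?_
  convert h2 using 3 with i
  rw [hB i, hBA, hA i, ← hA.apply_S, ← inner_T_left]
  have hw : ∀ n, (star (T i (star k))) n = ⟪v, S n (S i f)⟫ := by
    intro n
    simp [T_apply, hk, S_S]
  rw [inner_multiplier hA hw, star_star]

/-- The maximal Hankel operator is symmetric for the bilinear pairing. -/
lemma hankel_symm {v f g k l : ellTwo} (hk : ∀ n, k n = ⟪v, S n f⟫)
    (hl : ∀ n, l n = ⟪v, S n g⟫) : ⟪star l, f⟫ = ⟪star k, g⟫ := by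
  let ε : ℕ → ℂ := fun n => 1 / ((n : ℂ) + 1)
  have hε0 : ∀ n, ε n ≠ 0 := fun n => one_div_ne_zero (Nat.cast_add_one_ne_zero n)
  have hε1 : ∀ n, ‖ε n‖ ≤ 1 := by
    intro n
    have : ‖(n : ℂ) + 1‖ = n + 1 := by exact_mod_cast Complex.norm_natCast (n + 1)
    rw [norm_div, norm_one, this]
    exact div_le_one_of_le₀ (by linarith [n.cast_nonneg (α := ℝ)]) (by positivity)
  have hε : Tendsto (fun n => ‖ε n • f‖) atTop (𝓝 0) := by
    have h := tendsto_one_div_add_atTop_nhds_zero_nat (𝕜 := ℂ)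
    simpa [ε] using (h.smul_const f).norm
  choose A B hA hB hBA hn ha using fun n => exists_multipliers (ε n • f)
  have hle : ∀ n, ‖A n‖ ≤ √(1 + ‖f‖ ^ 2) := by
    refine fun n => (hn n).trans ?_
    gcongr
    rw [norm_smul]
    exact mul_le_of_le_one_left (norm_nonneg f) (hε1 n)
  have hA1 : ∀ x, Tendsto (fun n => A n x) atTop (𝓝 x) := by
    intro x
    rw [← tendsto_sub_nhds_zero_iff]
    refine tendsto_zero_of_basis (fun n => A n - ContinuousLinearMap.id ℂ ellTwo)
      (C := √(1 + ‖f‖ ^ 2) + ‖ContinuousLinearMap.id ℂ ellTwo‖)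
      (fun n => (norm_sub_le _ _).trans (by gcongr; exact hle n)) (fun j => ?_) x
    refine squeeze_zero_norm (fun n => ?_) hε
    have : (A n - ContinuousLinearMap.id ℂ ellTwo) (e j) = S j (A n (e 0) - e 0) := by
      simp [hA n j, S_e]
    rw [this, LinearIsometry.norm_map]
    exact ha n
  have heq : ∀ n, ⟪star l, A n f⟫ = ⟪star k, A n g⟫ := by
    intro n
    have hkε : ∀ m, (ε n • k) m = ⟪v, S m (ε n • f)⟫ := by
      intro m
      simp [hk]
    have h := inner_multiplier_symm (hA n) (hB n) (hBA n) hkε hl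
    rw [star_smul, map_smul, inner_smul_right, inner_smul_left] at h
    simpa [hε0 n] using h
  have h1 := (tendsto_const_nhds (x := star l)).inner (𝕜 := ℂ) (hA1 f)
  have h2 := (tendsto_const_nhds (x := star k)).inner (𝕜 := ℂ) (hA1 g)
  exact tendsto_nhds_unique h1 (h2.congr fun n => (heq n).symm)

lemma ip_eq_inner (f g : ellTwo) : ip f g = ⟪g, f⟫ := by
  simp [ip, lp.inner_eq_tsum]

lemma hankel_eq_inner {u : ellTwo} (hu : ∀ n, (u n).im = 0) (f : ellTwo) (m : ℕ) :
    hankel u f m = ⟪u, S m f⟫ := by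
  rw [← (hasSum_inner_S m u f).tsum_eq]
  simp [hankel, Complex.conj_eq_iff_im.2 (hu _)]

lemma hankel_e {u : ellTwo} (hu : ∀ n, (u n).im = 0) (n : ℕ) : hankel u (e n) = T n u := by
  ext m
  rw [hankel_eq_inner hu, S_e, inner_e_right, Complex.conj_eq_iff_im.2 (hu _), T_apply, add_comm]

/-- The maximal Hankel operator with real symbol is symmetric. -/
lemma inner_hankel_symm {u : ellTwo} (hu : ∀ n, (u n).im = 0) {f g h l : ellTwo}
    (hh : hankel u f = h) (hl : hankel u g = l) : ⟪f, l⟫ = ⟪h, g⟫ := by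
  have hS : ∀ n, S n (star f) = star (S n f) := by
    intro n
    ext m
    simp only [S_apply, lp.coeFn_star, Pi.star_apply]
    split_ifs <;> simp
  have hstar : star u = u := by
    ext m
    simpa using Complex.conj_eq_iff_im.2 (hu m)
  have h1 : ∀ n, (star h) n = ⟪u, S n (star f)⟫ := by
    intro n
    rw [lp.star_apply, ← hh, hankel_eq_inner hu, hS, ← inner_star_star, hstar]
    exact inner_conj_symm _ _
  have h2 : ∀ n, l n = ⟪u, S n g⟫ := fun n => by rw [← hl, hankel_eq_inner hu]
  have := hankel_symm h1 h2
  rwa [inner_star_star, star_star] at this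

lemma isClosed_graph {u : ellTwo} (hu : ∀ n, (u n).im = 0) :
    IsClosed {fg : ellTwo × ellTwo | ⇑fg.2 = hankel u fg.1} := by
  have hset : {fg : ellTwo × ellTwo | ⇑fg.2 = hankel u fg.1}
      = ⋂ m, {fg : ellTwo × ellTwo | ⟪e m, fg.2⟫ = ⟪u, S m fg.1⟫} := by
    ext fg
    simp [funext_iff, hankel_eq_inner hu, inner_e_left]
  rw [hset]
  exact isClosed_iInter fun m => isClosed_eq (continuous_const.inner continuous_snd)
    (continuous_const.inner ((S m).continuous.comp continuous_fst))

lemma mem_closure_graph {u : ellTwo} (hu : ∀ n, (u n).im = 0) {f k : ellTwo} (hk : hankel u f = k) :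
    (f, k) ∈ closure {fg : ellTwo × ellTwo | FinSupp fg.1 ∧ ⇑fg.2 = hankel u fg.1} := by
  let K : Submodule ℂ (WithLp 2 (ellTwo × ellTwo)) :=
    Submodule.span ℂ (Set.range fun n => WithLp.toLp 2 (e n, T n u))
  have hK : ∀ x ∈ K, FinSupp x.fst ∧ ⇑x.snd = hankel u x.fst := by
    intro x hx
    induction hx using Submodule.span_induction with
    | mem x hx =>
      obtain ⟨n, rfl⟩ := hx
      refine ⟨⟨n + 1, fun m hm => ?_⟩, (hankel_e hu n).symm⟩
      change (e n) m = 0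
      rw [e_apply, if_neg (by omega)]
    | zero =>
      refine ⟨⟨0, fun m _ => rfl⟩, ?_⟩
      ext m
      rw [hankel_eq_inner hu]
      simp
    | add x y _ _ hx hy =>
      obtain ⟨⟨M, hM⟩, hx⟩ := hx
      obtain ⟨⟨N, hN⟩, hy⟩ := hy
      refine ⟨⟨max M N, fun m hm => ?_⟩, ?_⟩
      · simp [hM m (by omega), hN m (by omega)]
      · ext m
        rw [hankel_eq_inner hu]
        simp only [WithLp.add_snd, WithLp.add_fst, lp.coeFn_add, Pi.add_apply, hx, hy, map_add,
          inner_add_right, hankel_eq_inner hu]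
    | smul c x _ hx =>
      obtain ⟨⟨M, hM⟩, hx⟩ := hx
      refine ⟨⟨M, fun m hm => by simp [hM m hm]⟩, ?_⟩
      ext m
      rw [hankel_eq_inner hu]
      simp [hx, hankel_eq_inner hu]
  have hmem : WithLp.toLp 2 (f, k) ∈ K.topologicalClosure := by
    rw [← Submodule.orthogonal_orthogonal_eq_closure, Submodule.mem_orthogonal]
    intro y hy
    have hy2 : hankel u y.snd = (-y.fst : ellTwo) := by
      ext n
      have := (Submodule.mem_orthogonal _ _).1 hy _ (Submodule.subset_span ⟨n, rfl⟩)
      rw [WithLp.prod_inner_apply] at this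
      change ⟪e n, y.fst⟫ + ⟪T n u, y.snd⟫ = 0 at this
      rw [inner_e_left, inner_T_left] at this
      rw [hankel_eq_inner hu, lp.coeFn_neg, Pi.neg_apply]
      exact eq_neg_of_add_eq_zero_right this
    have := inner_hankel_symm hu hy2 hk
    rw [WithLp.prod_inner_apply]
    change ⟪y.fst, f⟫ + ⟪y.snd, k⟫ = 0
    rw [this, inner_neg_left, add_neg_cancel]
  exact map_mem_closure (f := fun x : WithLp 2 (ellTwo × ellTwo) => (x.fst, x.snd))
    (WithLp.prodContinuousLinearEquiv 2 ℂ ellTwo ellTwo).continuous hmem hK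

end Hankel

open Hankel

/-- If all the entries of `u ∈ ℓ²` are real, then `Γ_u` restricted to finitely supported
sequences is essentially self-adjoint: its closure (whose graph is the closure of the graph of
the restriction of `Γ_u` to finitely supported sequences) equals the maximal operator `Γ_u`,
and the maximal operator satisfies `Γ_u* = Γ_u`, i.e. for `f, h ∈ ℓ²`,
`⟨Γ_u g, f⟩ = ⟨g, h⟩` for all `g ∈ Dom Γ_u` iff `f ∈ Dom Γ_u` and `Γ_u f = h`. -/
theorem stmt_4 (u : ellTwo) (hu : ∀ n, ((⇑u : ℕ → ℂ) n).im = 0) :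
    ({fg : ellTwo × ellTwo | ⇑fg.2 = hankel (⇑u) (⇑fg.1)} =
      closure {fg : ellTwo × ellTwo | FinSupp (⇑fg.1) ∧ ⇑fg.2 = hankel (⇑u) (⇑fg.1)}) ∧
    (∀ f h : ellTwo,
      (∀ g : ellTwo, Memℓp (hankel (⇑u) (⇑g)) 2 →
          ip (hankel (⇑u) (⇑g)) (⇑f) = ip (⇑g) (⇑h)) ↔
        (Memℓp (hankel (⇑u) (⇑f)) 2 ∧ hankel (⇑u) (⇑f) = ⇑h)) := by
  refine ⟨Set.Subset.antisymm (fun fg hfg => mem_closure_graph hu (Eq.symm hfg))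
    (closure_minimal (fun fg hfg => hfg.2) (isClosed_graph hu)), fun f h => ⟨fun H => ?_, ?_⟩⟩
  · have hf : hankel u f = h := by
      ext n
      have hn := H (e n) (by rw [hankel_e hu]; exact lp.memℓp _)
      rw [hankel_e hu, ip_eq_inner, ip_eq_inner, inner_T_right, inner_e_right] at hn
      rw [hankel_eq_inner hu, ← inner_conj_symm, hn, Complex.conj_conj]
    exact ⟨hf ▸ lp.memℓp h, hf⟩
  · rintro ⟨-, hf⟩ g hg
    have hl : hankel u g = (⟨hankel u g, hg⟩ : ellTwo) := rfl
    rw [hl, ip_eq_inner, ip_eq_inner]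
    exact inner_hankel_symm hu hf hl
end
end

section
/- Let u ∈ ℓ²(ℕ, ℂ) and let (u_k) be a sequence in ℓ²(ℕ, ℂ) with ‖u_k − u‖ → 0. Then Γ_{u_k}*Γ_{u_k} → Γ_u*Γ_u in the strong resolvent sense. Concretely: let λ ∈ ℂ with Im λ ≠ 0 and f ∈ ℓ², and suppose that for each k, φ_k ∈ ℓ² satisfies φ_k ∈ Dom Γ_{u_k}, Γ_{u_k} φ_k ∈ Dom Γ_{u_k♯}, and Γ_{u_k♯}(Γ_{u_k} φ_k) = λ φ_k + f, and similarly φ ∈ ℓ² satisfies φ ∈ Dom Γ_u, Γ_u φ ∈ Dom Γ_{u♯}, and Γ_{u♯}(Γ_u φ) = λ φ + f. Then ‖φ_k − φ‖ → 0 as k → ∞. -/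
open scoped ComplexConjugate
open Filter

noncomputable section

/-- `u♯(n) = conj (u n)`. -/
def sharp (u : ℕ → ℂ) : ℕ → ℂ := fun n => conj (u n)


section HankelSymmetry

open Finset hiding mk
open PowerSeries Topology

/-- Square-summability of a complex sequence. -/
def SqSummable (x : ℕ → ℂ) : Prop := Summable fun n => ‖x n‖ ^ 2

theorem memlp_two_iff_sqSummable {x : ℕ → ℂ} : Memℓp x 2 ↔ SqSummable x := by
  rw [memℓp_gen_iff (by norm_num)]
  simp [SqSummable]

namespace SqSummable

variable {x y w : ℕ → ℂ}

theorem of_sum_range_le {C : ℝ} (h : ∀ K, ∑ n ∈ range K, ‖x n‖ ^ 2 ≤ C) : SqSummable x :=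
  summable_of_sum_range_le (fun _ => by positivity) h

theorem sum_range_le (hx : SqSummable x) (K : ℕ) :
    ∑ n ∈ range K, ‖x n‖ ^ 2 ≤ ∑' n, ‖x n‖ ^ 2 :=
  Summable.sum_le_tsum _ (fun _ _ => by positivity) hx

theorem add (hx : SqSummable x) (hy : SqSummable y) : SqSummable fun n => x n + y n :=
  memlp_two_iff_sqSummable.1
    ((memlp_two_iff_sqSummable.2 hx).add (memlp_two_iff_sqSummable.2 hy))

theorem sub (hx : SqSummable x) (hy : SqSummable y) : SqSummable fun n => x n - y n :=
  memlp_two_iff_sqSummable.1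
    ((memlp_two_iff_sqSummable.2 hx).sub (memlp_two_iff_sqSummable.2 hy))

theorem star (hx : SqSummable x) : SqSummable fun n => conj (x n) := by
  simpa [SqSummable] using hx

theorem shift (hx : SqSummable x) (m : ℕ) : SqSummable fun n => x (n + m) :=
  (summable_nat_add_iff (f := fun n => ‖x n‖ ^ 2) m).2 hx

theorem summable_norm_mul (hx : SqSummable x) (hy : SqSummable y) :
    Summable fun n => ‖x n‖ * ‖y n‖ := by
  refine Summable.of_nonneg_of_le (fun _ => by positivity) (fun n => ?_) (Summable.add hx hy)
  nlinarith [sq_nonneg (‖x n‖ - ‖y n‖), sq_nonneg ‖x n‖, sq_nonneg ‖y n‖]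

theorem summable_mul (hx : SqSummable x) (hy : SqSummable y) : Summable fun n => x n * y n :=
  Summable.of_norm (by simpa using hx.summable_norm_mul hy)

theorem norm_tsum_mul_sq_le (hx : SqSummable x) (hy : SqSummable y) :
    ‖∑' n, x n * y n‖ ^ 2 ≤ (∑' n, ‖x n‖ ^ 2) * ∑' n, ‖y n‖ ^ 2 := by
  refine le_of_tendsto (((hx.summable_mul hy).hasSum.tendsto_sum_nat.norm).pow 2)
    (Eventually.of_forall fun K => ?_)
  calc ‖∑ n ∈ range K, x n * y n‖ ^ 2
      ≤ (∑ n ∈ range K, ‖x n‖ * ‖y n‖) ^ 2 := by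
        gcongr
        exact (norm_sum_le _ _).trans_eq (by simp)
    _ ≤ (∑ n ∈ range K, ‖x n‖ ^ 2) * ∑ n ∈ range K, ‖y n‖ ^ 2 :=
        sum_mul_sq_le_sq_mul_sq _ _ _
    _ ≤ _ := mul_le_mul (hx.sum_range_le K) (hy.sum_range_le K)
        (sum_nonneg fun _ _ => by positivity) (tsum_nonneg fun _ => by positivity)

theorem norm_tsum_mul_le (hx : SqSummable x) (hy : SqSummable y) :
    ‖∑' n, x n * y n‖ ≤ √(∑' n, ‖x n‖ ^ 2) * √(∑' n, ‖y n‖ ^ 2) := by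
  rw [← Real.sqrt_mul (tsum_nonneg fun _ => by positivity)]
  exact Real.le_sqrt_of_sq_le (hx.norm_tsum_mul_sq_le hy)

end SqSummable

section WeakLimits

variable {ι : Type*} {l : Filter ι} {x : ι → ℕ → ℂ} {y : ℕ → ℂ} {C : ℝ}

theorem sum_range_le_of_tendsto [l.NeBot] (hC : ∀ i K, ∑ n ∈ range K, ‖x i n‖ ^ 2 ≤ C)
    (hx : ∀ n, Tendsto (fun i => x i n) l (𝓝 (y n))) (K : ℕ) :
    ∑ n ∈ range K, ‖y n‖ ^ 2 ≤ C :=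
  le_of_tendsto (tendsto_finsetSum _ fun n _ => ((hx n).norm.pow 2))
    (Eventually.of_forall fun i => hC i K)

theorem tsum_sq_le {x : ℕ → ℂ} (hC : ∀ K, ∑ n ∈ range K, ‖x n‖ ^ 2 ≤ C) :
    ∑' n, ‖x n‖ ^ 2 ≤ C :=
  (SqSummable.of_sum_range_le hC).tsum_le_of_sum_range_le hC

/-- Bounded coordinatewise convergence in `ℓ²` is weak convergence. -/
theorem tendsto_tsum_mul_of_bounded {w : ℕ → ℂ} (hw : SqSummable w)
    (hC : ∀ i K, ∑ n ∈ range K, ‖x i n‖ ^ 2 ≤ C)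
    (hx : ∀ n, Tendsto (fun i => x i n) l (𝓝 (y n))) :
    Tendsto (fun i => ∑' n, w n * x i n) l (𝓝 (∑' n, w n * y n)) := by
  rcases l.eq_or_neBot with rfl | hl
  · exact tendsto_bot
  have hxs : ∀ i, SqSummable (x i) := fun i => .of_sum_range_le (hC i)
  have hys : SqSummable y := .of_sum_range_le (sum_range_le_of_tendsto hC hx)
  have hC0 : 0 ≤ C := tsum_nonneg (fun _ => by positivity) |>.trans
    (tsum_sq_le (sum_range_le_of_tendsto hC hx))
  have tail : ∀ z : ℕ → ℂ, (∀ K, ∑ n ∈ range K, ‖z n‖ ^ 2 ≤ C) → ∀ K,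
      ‖∑' n, w n * z n - ∑ n ∈ range K, w n * z n‖ ≤ √(∑' n, ‖w (n + K)‖ ^ 2) * √C := by
    intro z hz K
    have hzs : SqSummable z := .of_sum_range_le hz
    rw [← (hw.summable_mul hzs).sum_add_tsum_nat_add K, add_sub_cancel_left]
    refine ((hw.shift K).norm_tsum_mul_le (hzs.shift K)).trans ?_
    gcongr
    refine le_trans ?_ (tsum_sq_le hz)
    rw [← Summable.sum_add_tsum_nat_add K hzs]
    exact le_add_of_nonneg_left (sum_nonneg fun _ _ => by positivity)
  have htail : Tendsto (fun K => √(∑' n, ‖w (n + K)‖ ^ 2) * √C) atTop (𝓝 0) := by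
    have := (Real.continuous_sqrt.tendsto _).comp
      (tendsto_sum_nat_add fun n => ‖w n‖ ^ 2)
    simpa using this.mul_const √C
  rw [Metric.tendsto_nhds]
  intro ε hε
  obtain ⟨K, hK⟩ := (htail.eventually (gt_mem_nhds (show (0 : ℝ) < ε / 3 by positivity))).exists
  have hfin : Tendsto (fun i => ∑ n ∈ range K, w n * x i n) l (𝓝 (∑ n ∈ range K, w n * y n)) :=
    tendsto_finsetSum _ fun n _ => (hx n).const_mul _
  filter_upwards [Metric.tendsto_nhds.1 hfin (ε / 3) (by positivity)] with i hi
  have h1 := (tail (x i) (hC i) K).trans_lt hK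
  have h2 := (tail y (sum_range_le_of_tendsto hC hx) K).trans_lt hK
  rw [← dist_eq_norm] at h1 h2
  rw [dist_comm] at h2
  linarith [dist_triangle4 (∑' n, w n * x i n) (∑ n ∈ range K, w n * x i n)
    (∑ n ∈ range K, w n * y n) (∑' n, w n * y n)]

/-- Pairing a norm-convergent family with a weakly convergent one. -/
theorem tendsto_tsum_mul_of_tendsto {w : ι → ℕ → ℂ} {v : ℕ → ℂ} (hw : ∀ i, SqSummable (w i))
    (hv : SqSummable v) (hwv : Tendsto (fun i => ∑' n, ‖w i n - v n‖ ^ 2) l (𝓝 0))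
    (hC : ∀ i K, ∑ n ∈ range K, ‖x i n‖ ^ 2 ≤ C)
    (hx : ∀ n, Tendsto (fun i => x i n) l (𝓝 (y n))) :
    Tendsto (fun i => ∑' n, w i n * x i n) l (𝓝 (∑' n, v n * y n)) := by
  have hxs : ∀ i, SqSummable (x i) := fun i => .of_sum_range_le (hC i)
  have hdiff : Tendsto (fun i => ∑' n, (w i n - v n) * x i n) l (𝓝 0) := by
    have h0 : Tendsto (fun i => √(∑' n, ‖w i n - v n‖ ^ 2) * √C) l (𝓝 0) := by
      have := (Real.continuous_sqrt.tendsto _).comp hwv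
      simpa using this.mul_const √C
    refine squeeze_zero_norm (fun i => ?_) h0
    refine (((hw i).sub hv).norm_tsum_mul_le (hxs i)).trans ?_
    gcongr
    exact tsum_sq_le (hC i)
  have := hdiff.add (tendsto_tsum_mul_of_bounded hv hC hx)
  rw [zero_add] at this
  refine this.congr fun i => ?_
  rw [← Summable.tsum_add (((hw i).sub hv).summable_mul (hxs i)) (hv.summable_mul (hxs i))]
  exact tsum_congr fun n => by ring

end WeakLimits

/-- Multiplication by the power series `F` is bounded on `ℓ²`, with squared norm at most `C`. As the
multiplication is lower triangular, this can be tested on initial segments. -/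
def MulBound (F : ℂ⟦X⟧) (C : ℝ) : Prop :=
  ∀ (G : ℂ⟦X⟧) (K : ℕ),
    ∑ n ∈ range K, ‖coeff n (F * G)‖ ^ 2 ≤ C * ∑ n ∈ range K, ‖coeff n G‖ ^ 2

theorem coeff_mk_sum_mul (p : ℕ → ℂ) (M : ℕ) (G : ℂ⟦X⟧) (k : ℕ) :
    coeff k (mk (fun n => if n < M then p n else 0) * G)
      = ∑ n ∈ range M, p n * coeff k (X ^ n * G) := by
  have : mk (fun n => if n < M then p n else 0) = ∑ n ∈ range M, C (p n) * X ^ n := by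
    ext j
    simp [coeff_X_pow]
  rw [this, Finset.sum_mul, map_sum]
  exact sum_congr rfl fun n _ => by rw [mul_assoc, coeff_C_mul]

theorem hasSum_mul_coeff_X_pow_mul {w : ℕ → ℂ} (hw : SqSummable w) {G : ℂ⟦X⟧}
    (hG : SqSummable fun n => coeff n G) (m : ℕ) :
    HasSum (fun k => w k * coeff k (X ^ m * G)) (∑' n, w (n + m) * coeff n G) := by
  have h := ((hw.shift m).summable_mul hG).hasSum
  rw [← hasSum_nat_add_iff' m, sum_eq_zero, sub_zero]
  · simpa [coeff_X_pow_mul'] using h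
  · intro i hi
    simp [coeff_X_pow_mul', (mem_range.1 hi)]

/-- Pairing with a polynomial multiple. -/
theorem tsum_mul_coeff_mk_mul {w : ℕ → ℂ} (hw : SqSummable w) {G : ℂ⟦X⟧}
    (hG : SqSummable fun n => coeff n G) (p : ℕ → ℂ) (M : ℕ) :
    ∑' k, w k * coeff k (mk (fun n => if n < M then p n else 0) * G)
      = ∑ m ∈ range M, p m * ∑' n, w (n + m) * coeff n G := by
  have h := hasSum_sum fun m (_ : m ∈ range M) =>
    (hasSum_mul_coeff_X_pow_mul hw hG m).mul_left (p m)
  rw [← h.tsum_eq]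
  refine tsum_congr fun k => ?_
  rw [coeff_mk_sum_mul, mul_sum]
  exact sum_congr rfl fun n _ => by ring

theorem coeff_mul_eq_sum_range (F G : ℂ⟦X⟧) (k : ℕ) :
    coeff k (F * G) = ∑ j ∈ range (k + 1), coeff (k - j) F * coeff j G := by
  rw [mul_comm, coeff_mul, Nat.sum_antidiagonal_eq_sum_range_succ
    (fun i j => coeff i G * coeff j F)]
  exact sum_congr rfl fun j _ => mul_comm _ _

/-- The Fejér mean of order `N` of a power series. -/
def fejer (N : ℕ) (F : ℂ⟦X⟧) : ℂ⟦X⟧ :=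
  mk fun n => if n < N then ((N - n : ℕ) : ℂ) / N * coeff n F else 0

theorem card_windows {j k N : ℕ} (hjk : j ≤ k) :
    #{s ∈ Ico k (k + N) | s < j + N} = N - (k - j) := by
  have : {s ∈ Ico k (k + N) | s < j + N} = Ico k (j + N) := by
    ext s; simp only [mem_filter, mem_Ico]; omega
  rw [this, Nat.card_Ico]; omega

theorem coeff_fejer_mul (N : ℕ) (F G : ℂ⟦X⟧) (k : ℕ) :
    (N : ℂ) * coeff k (fejer N F * G) = ∑ s ∈ Ico k (k + N),
      coeff k (F * mk fun j => if j ≤ s ∧ s < j + N then coeff j G else 0) := by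
  rcases N.eq_zero_or_pos with rfl | hN
  · simp
  simp_rw [coeff_mul_eq_sum_range]
  rw [sum_comm, mul_sum]
  refine sum_congr rfl fun j hj => ?_
  have hjk : j ≤ k := Nat.lt_succ_iff.1 (mem_range.1 hj)
  have h : ∀ s ∈ Ico k (k + N), coeff (k - j) F *
      coeff j (mk fun j => if j ≤ s ∧ s < j + N then coeff j G else 0)
      = if s < j + N then coeff (k - j) F * coeff j G else 0 := by
    intro s hs
    have : j ≤ s := hjk.trans (mem_Ico.1 hs).1
    simp [this]
  rw [sum_congr rfl h, ← sum_filter, sum_const, card_windows hjk, nsmul_eq_mul, fejer, coeff_mk]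
  have : (N : ℂ) ≠ 0 := by exact_mod_cast hN.ne'
  split_ifs with hlt
  · field_simp
  · rw [Nat.sub_eq_zero_of_le (not_lt.1 hlt)]; simp

theorem MulBound.fejer {F : ℂ⟦X⟧} {C : ℝ} (hF : MulBound F C) (N : ℕ) (hN : 0 < N) :
    MulBound (fejer N F) C := by
  intro G K
  have hN' : (0 : ℝ) < N := by exact_mod_cast hN
  set Q : ℕ → ℂ⟦X⟧ := fun s => mk fun j => if j ≤ s ∧ s < j + N then coeff j G else 0 with hQ
  have hQn : ∀ s n, ‖coeff n (Q s)‖ ^ 2 = if n ≤ s ∧ s < n + N then ‖coeff n G‖ ^ 2 else 0 := by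
    intro s n
    simp only [hQ, coeff_mk]
    split_ifs <;> simp
  have h1 : ∀ k ∈ range K, (N : ℝ) * ‖coeff k (_root_.fejer N F * G)‖ ^ 2
      ≤ ∑ s ∈ range (K + N), ‖coeff k (F * Q s)‖ ^ 2 := by
    intro k hk
    have h2 : ((N : ℝ) * ‖coeff k (_root_.fejer N F * G)‖) ^ 2
        ≤ N * ∑ s ∈ Ico k (k + N), ‖coeff k (F * Q s)‖ ^ 2 := by
      have h3 : (N : ℝ) * ‖coeff k (_root_.fejer N F * G)‖
          ≤ ∑ s ∈ Ico k (k + N), ‖coeff k (F * Q s)‖ := by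
        have := congrArg norm (coeff_fejer_mul N F G k)
        rw [norm_mul, Complex.norm_natCast] at this
        exact this.le.trans (norm_sum_le _ _)
      refine (pow_le_pow_left₀ (by positivity) h3 2).trans ?_
      simpa using sq_sum_le_card_mul_sum_sq (s := Ico k (k + N)) (f := fun s => ‖coeff k (F * Q s)‖)
    have h4 : ∑ s ∈ Ico k (k + N), ‖coeff k (F * Q s)‖ ^ 2
        ≤ ∑ s ∈ range (K + N), ‖coeff k (F * Q s)‖ ^ 2 := by
      refine sum_le_sum_of_subset_of_nonneg (fun s hs => ?_) fun _ _ _ => by positivity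
      have := mem_range.1 hk
      simp only [mem_Ico, mem_range] at hs ⊢
      omega
    refine le_trans ?_ h4
    rw [mul_pow, sq, mul_assoc] at h2
    exact le_of_mul_le_mul_left h2 hN'
  have hC0 : 0 ≤ C := by simpa using (sum_nonneg fun _ _ => by positivity).trans (hF 1 1)
  have h5 : ∀ n ∈ range K, ∑ s ∈ range (K + N), ‖coeff n (Q s)‖ ^ 2 ≤ N * ‖coeff n G‖ ^ 2 := by
    intro n _
    simp_rw [hQn]
    rw [← sum_filter, sum_const, nsmul_eq_mul]
    gcongr
    refine (card_le_card (t := Ico n (n + N)) fun s hs => ?_).trans (by simp)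
    simpa using (mem_filter.1 hs).2
  refine le_of_mul_le_mul_left ?_ hN'
  calc (N : ℝ) * ∑ n ∈ range K, ‖coeff n (_root_.fejer N F * G)‖ ^ 2
      ≤ ∑ n ∈ range K, ∑ s ∈ range (K + N), ‖coeff n (F * Q s)‖ ^ 2 := by
        rw [mul_sum]; exact sum_le_sum h1
    _ = ∑ s ∈ range (K + N), ∑ n ∈ range K, ‖coeff n (F * Q s)‖ ^ 2 := sum_comm
    _ ≤ ∑ s ∈ range (K + N), C * ∑ n ∈ range K, ‖coeff n (Q s)‖ ^ 2 :=
        sum_le_sum fun s _ => hF _ _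
    _ = C * ∑ n ∈ range K, ∑ s ∈ range (K + N), ‖coeff n (Q s)‖ ^ 2 := by
        rw [← mul_sum, sum_comm]
    _ ≤ C * ∑ n ∈ range K, N * ‖coeff n G‖ ^ 2 := by gcongr with n hn; exact h5 n hn
    _ = N * (C * ∑ n ∈ range K, ‖coeff n G‖ ^ 2) := by rw [← mul_sum]; ring

theorem MulBound.sum_range_mul_le {F G : ℂ⟦X⟧} {C : ℝ} (hF : MulBound F C)
    (hG : SqSummable fun n => coeff n G) (K : ℕ) :
    ∑ n ∈ range K, ‖coeff n (F * G)‖ ^ 2 ≤ C * ∑' n, ‖coeff n G‖ ^ 2 := by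
  have hC0 : 0 ≤ C := by simpa using (sum_nonneg fun _ _ => by positivity).trans (hF 1 1)
  exact (hF G K).trans (mul_le_mul_of_nonneg_left (hG.sum_range_le K) hC0)

theorem MulBound.sqSummable_mul {F G : ℂ⟦X⟧} {C : ℝ} (hF : MulBound F C)
    (hG : SqSummable fun n => coeff n G) : SqSummable fun n => coeff n (F * G) :=
  .of_sum_range_le (hF.sum_range_mul_le hG)

theorem sqSummable_coeff_one : SqSummable fun n => coeff n (1 : ℂ⟦X⟧) := by
  refine summable_of_ne_finset_zero (s := {0}) fun n hn => ?_
  simp [coeff_one, (by simpa using hn : n ≠ 0)]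

theorem MulBound.sqSummable {F : ℂ⟦X⟧} {C : ℝ} (hF : MulBound F C) :
    SqSummable fun n => coeff n F := by
  simpa using hF.sqSummable_mul sqSummable_coeff_one

theorem tendsto_fejer (F G : ℂ⟦X⟧) (k : ℕ) :
    Tendsto (fun N => coeff k (fejer (N + 1) F * G)) atTop (𝓝 (coeff k (F * G))) := by
  have hF : ∀ n, Tendsto (fun N => coeff n (fejer (N + 1) F)) atTop (𝓝 (coeff n F)) := by
    intro n
    have h : Tendsto (fun N : ℕ => (1 - (n : ℂ) * (1 / ((N : ℂ) + 1))) * coeff n F) atTop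
        (𝓝 (coeff n F)) := by
      simpa using ((tendsto_one_div_add_atTop_nhds_zero_nat (𝕜 := ℂ)).const_mul (n : ℂ)
        |>.const_sub 1).mul_const (coeff n F)
    refine h.congr' ?_
    filter_upwards [eventually_ge_atTop n] with N hN
    have h0 : (N : ℂ) + 1 ≠ 0 := by exact_mod_cast N.succ_ne_zero
    rw [fejer, coeff_mk, if_pos (by omega), Nat.cast_sub (by omega)]
    push_cast
    field_simp
  simp_rw [coeff_mul]
  exact tendsto_finsetSum _ fun p _ => (hF p.1).mul_const _

/-- A Hankel operator commutes with a bounded multiplier, up to transposition. -/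
theorem tsum_mul_hankel_of_mulBound {u v : ℕ → ℂ} {F : ℂ⟦X⟧} {C : ℝ} (hF : MulBound F C)
    (hu : SqSummable u) (hv : SqSummable v) (huv : SqSummable (hankel u v)) :
    ∑' n, coeff n F * hankel u v n = ∑' k, u k * coeff k (F * mk v) := by
  have hv' : SqSummable fun n => coeff n (mk v) := by simpa using hv
  have h1 : Tendsto (fun N => ∑' k, u k * coeff k (fejer (N + 1) F * mk v)) atTop
      (𝓝 (∑' k, u k * coeff k (F * mk v))) :=
    tendsto_tsum_mul_of_bounded hu
      (fun N => (hF.fejer (N + 1) N.succ_pos).sum_range_mul_le hv') (tendsto_fejer F (mk v))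
  have h2 : Tendsto (fun N => ∑' n, hankel u v n * coeff n (fejer (N + 1) F)) atTop
      (𝓝 (∑' n, hankel u v n * coeff n F)) :=
    tendsto_tsum_mul_of_bounded huv
      (fun N => by simpa using (hF.fejer (N + 1) N.succ_pos).sum_range_mul_le sqSummable_coeff_one)
      (by simpa using tendsto_fejer F 1)
  simp_rw [mul_comm (coeff _ F)]
  refine tendsto_nhds_unique h2 (h1.congr fun N => ?_)
  rw [fejer, tsum_mul_coeff_mk_mul hu hv', tsum_eq_sum (s := range (N + 1))]
  · refine sum_congr rfl fun n hn => ?_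
    rw [coeff_mk, if_pos (mem_range.1 hn), mul_comm]
    simp [hankel, add_comm]
  · intro n hn
    rw [coeff_mk, if_neg (by simpa using hn), mul_zero]

/-- The autocorrelation `m ↦ ⟨f, Sᵐ f⟩` of a sequence, with `S` the shift. -/
def autocorr (f : ℕ → ℂ) (m : ℕ) : ℂ := ∑' n, conj (f n) * f (n + m)

/-- The analytic completion of `|f|²`: a power series whose real part on the circle is `|f|²`. -/
def analyticSq (f : ℕ → ℂ) : ℂ⟦X⟧ :=
  mk fun n => if n = 0 then autocorr f 0 else 2 * autocorr f n

theorem sqSummable_coeff_X_pow_mul {f : ℕ → ℂ} (hf : SqSummable f) (k : ℕ) :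
    SqSummable fun n => coeff n (X ^ k * mk f) := by
  refine (summable_nat_add_iff (f := fun n => ‖coeff n (X ^ k * mk f)‖ ^ 2) k).1 ?_
  simpa [coeff_X_pow_mul, SqSummable] using hf

theorem sum_sum_symm_eq (m : ℕ → ℕ → ℝ) (hm : ∀ j k, m j k = m k j) (N : ℕ) :
    ∑ j ∈ range N, ∑ k ∈ range N, m j k
      = ∑ j ∈ range N, (∑ k ∈ range j, 2 * m j k + m j j) := by
  induction N with
  | zero => simp
  | succ N ih =>
    simp_rw [sum_range_succ _ N, sum_add_distrib]
    rw [sum_add_distrib] at ih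
    rw [ih, ← mul_sum, sum_congr rfl fun j _ => hm j N]
    ring

/-- The Gram matrix of the shifts of `f`. -/
def shiftGram (f : ℕ → ℂ) (j k : ℕ) : ℂ :=
  ∑' n, conj (f n) * coeff (n + j) (X ^ k * mk f)

theorem shiftGram_of_le (f : ℕ → ℂ) {j k : ℕ} (h : k ≤ j) :
    shiftGram f j k = autocorr f (j - k) := by
  refine tsum_congr fun n => ?_
  rw [show n + j = n + (j - k) + k by omega, coeff_X_pow_mul, coeff_mk]

theorem conj_shiftGram_of_le {f : ℕ → ℂ} (hf : SqSummable f) {j k : ℕ} (h : k ≤ j) :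
    conj (shiftGram f k j) = shiftGram f j k := by
  rw [shiftGram_of_le f h, shiftGram]
  have h1 : ∀ n, conj (f n) * coeff (n + k) (X ^ j * mk f)
      = conj (f n) * coeff n (X ^ (j - k) * mk f) := by
    intro n
    conv_lhs => rw [show j = (j - k) + k by omega, pow_add, mul_comm (X ^ _), mul_assoc,
      coeff_X_pow_mul]
  rw [tsum_congr h1, (hasSum_mul_coeff_X_pow_mul hf.star (by simpa using hf) (j - k)).tsum_eq,
    Complex.conj_tsum, autocorr]
  exact tsum_congr fun n => by simp [mul_comm]

theorem conj_shiftGram {f : ℕ → ℂ} (hf : SqSummable f) (j k : ℕ) :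
    conj (shiftGram f k j) = shiftGram f j k := by
  rcases le_total k j with h | h
  · exact conj_shiftGram_of_le hf h
  · rw [← conj_shiftGram_of_le hf h, Complex.conj_conj]

theorem sum_range_sq_mul_le_re {f : ℕ → ℂ} (hf : SqSummable f) (G : ℂ⟦X⟧) (N : ℕ) :
    ∑ n ∈ range N, ‖coeff n (mk f * G)‖ ^ 2
      ≤ ∑ j ∈ range N, (conj (coeff j G) * coeff j (analyticSq f * G)).re := by
  set y : ℕ → ℂ := fun n => coeff n G with hy
  set P : ℂ⟦X⟧ := mk (fun n => if n < N then y n else 0) * mk f with hP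
  have hPs : SqSummable fun n => coeff n P := by
    have : ∀ M : ℕ, SqSummable fun n => ∑ k ∈ range M, y k * coeff n (X ^ k * mk f) := by
      intro M
      induction M with
      | zero => simp [SqSummable, summable_zero]
      | succ M ih =>
        simp_rw [sum_range_succ]
        refine ih.add ?_
        have := (sqSummable_coeff_X_pow_mul hf M).mul_left (‖y M‖ ^ 2)
        simpa [SqSummable, mul_pow] using this
    simpa only [hP, coeff_mk_sum_mul] using this N
  have hlow : ∀ n ∈ range N, coeff n (mk f * G) = coeff n P := by
    intro n hn
    rw [hP, mul_comm (mk f), coeff_mul, coeff_mul]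
    refine sum_congr rfl fun p hp => ?_
    have h1 := mem_antidiagonal.1 hp
    have h2 := mem_range.1 hn
    rw [coeff_mk (n := p.1), if_pos (by omega)]
  have hconj : ∀ n, conj (coeff n P)
      = coeff n (mk (fun n => if n < N then conj (y n) else 0) * mk fun n => conj (f n)) := by
    intro n
    rw [hP, coeff_mul, coeff_mul, map_sum]
    refine sum_congr rfl fun p _ => ?_
    simp only [coeff_mk, map_mul]
    split_ifs <;> simp
  have henergy : ((∑' n, ‖coeff n P‖ ^ 2 : ℝ) : ℂ)
      = ∑ j ∈ range N, ∑ k ∈ range N, conj (y j) * y k * shiftGram f j k := by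
    calc ((∑' n, ‖coeff n P‖ ^ 2 : ℝ) : ℂ)
        = ∑' n, coeff n P * coeff n (mk (fun n => if n < N then conj (y n) else 0)
            * mk fun n => conj (f n)) := by
          rw [Complex.ofReal_tsum]
          refine tsum_congr fun n => ?_
          rw [← hconj, Complex.mul_conj, Complex.normSq_eq_norm_sq]
      _ = _ := by
          rw [tsum_mul_coeff_mk_mul hPs (by simpa using hf.star)]
          refine sum_congr rfl fun j _ => ?_
          simp_rw [mul_assoc]
          rw [← mul_sum]
          congr 1
          have h : ∀ n, coeff (n + j) P * coeff n (mk fun n => conj (f n))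
              = ∑ k ∈ range N, y k * (conj (f n) * coeff (n + j) (X ^ k * mk f)) := by
            intro n
            rw [hP, coeff_mk_sum_mul, coeff_mk, sum_mul]
            exact sum_congr rfl fun k _ => by ring
          rw [tsum_congr h, Summable.tsum_finsetSum]
          · exact sum_congr rfl fun k _ => tsum_mul_left
          · exact fun k _ => (hf.star.summable_mul
              ((sqSummable_coeff_X_pow_mul hf k).shift j)).mul_left _
  rw [sum_congr rfl fun n hn => by rw [hlow n hn]]
  refine (hPs.sum_range_le N).trans_eq ?_
  rw [← Complex.ofReal_re (∑' n, ‖coeff n P‖ ^ 2), henergy, Complex.re_sum]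
  simp_rw [Complex.re_sum]
  rw [sum_sum_symm_eq]
  · refine sum_congr rfl fun j _ => ?_
    rw [coeff_mul_eq_sum_range, sum_range_succ, mul_add, Complex.add_re, mul_sum, Complex.re_sum]
    congr 1
    · refine sum_congr rfl fun k hk => ?_
      have hk := mem_range.1 hk
      rw [shiftGram_of_le f hk.le, analyticSq, coeff_mk, if_neg (by omega),
        show conj (coeff j G) * (2 * autocorr f (j - k) * coeff k G)
          = ((2 : ℝ) : ℂ) * (conj (y j) * y k * autocorr f (j - k)) by push_cast [hy]; ring,
        Complex.re_ofReal_mul]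
    · rw [shiftGram_of_le f le_rfl, Nat.sub_self, analyticSq, coeff_mk, if_pos rfl]
      congr 1
      simp only [hy]
      ring
  · intro j k
    rw [← Complex.conj_re, map_mul, map_mul, Complex.conj_conj, conj_shiftGram hf,
      mul_comm (y j)]

/-- The multiplier `1 / (1 + ε g)`, where `g` is the analytic completion of `|f|²`. -/
def outerMul (f : ℕ → ℂ) (ε : ℝ) : ℂ⟦X⟧ := (1 + C (ε : ℂ) * analyticSq f)⁻¹

theorem mul_outerMul (f : ℕ → ℂ) {ε : ℝ} (hε : 0 < ε) :
    (1 + C (ε : ℂ) * analyticSq f) * outerMul f ε = 1 := by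
  refine PowerSeries.mul_inv_cancel _ fun h => ?_
  have h0 : autocorr f 0 = ((∑' n, ‖f n‖ ^ 2 : ℝ) : ℂ) := by
    rw [Complex.ofReal_tsum]
    refine tsum_congr fun n => ?_
    rw [add_zero, mul_comm, Complex.mul_conj, Complex.normSq_eq_norm_sq]
  have h1 : constantCoeff (analyticSq f) = autocorr f 0 := by
    rw [← coeff_zero_eq_constantCoeff_apply, analyticSq, coeff_mk, if_pos rfl]
  rw [map_add, map_mul, map_one, constantCoeff_C, h1, h0] at h
  have h2 : 1 + ε * ∑' n, ‖f n‖ ^ 2 = 0 := by exact_mod_cast h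
  have h3 : 0 ≤ ∑' n, ‖f n‖ ^ 2 := tsum_nonneg fun _ => by positivity
  nlinarith [mul_nonneg hε.le h3]

theorem outerMul_energy {f : ℕ → ℂ} (hf : SqSummable f) {ε : ℝ} (hε : 0 < ε) (G : ℂ⟦X⟧) (K : ℕ) :
    ∑ n ∈ range K, ‖coeff n (outerMul f ε * G)‖ ^ 2
        + 2 * ε * ∑ n ∈ range K, ‖coeff n (mk f * outerMul f ε * G)‖ ^ 2
      ≤ ∑ n ∈ range K, ‖coeff n G‖ ^ 2 := by
  set Y := outerMul f ε * G with hY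
  have hG : G = Y + C (ε : ℂ) * (analyticSq f * Y) := by
    calc G = (1 + C (ε : ℂ) * analyticSq f) * outerMul f ε * G := by
          rw [mul_outerMul f hε, one_mul]
      _ = _ := by rw [hY]; ring
  have h1 := sum_range_sq_mul_le_re hf Y K
  have h2 : ∀ n, ‖coeff n Y‖ ^ 2
      + 2 * ε * (conj (coeff n Y) * coeff n (analyticSq f * Y)).re ≤ ‖coeff n G‖ ^ 2 := by
    intro n
    conv_rhs => rw [hG, map_add, coeff_C_mul]
    rw [← Complex.normSq_eq_norm_sq, ← Complex.normSq_eq_norm_sq, Complex.normSq_apply,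
      Complex.normSq_apply]
    simp only [Complex.mul_re, Complex.conj_re, Complex.conj_im, Complex.add_re, Complex.add_im,
      Complex.ofReal_re, Complex.ofReal_im, Complex.mul_im]
    nlinarith [sq_nonneg (ε * (coeff n (analyticSq f * Y)).re),
      sq_nonneg (ε * (coeff n (analyticSq f * Y)).im)]
  rw [mul_assoc (mk f), ← hY]
  calc _ ≤ ∑ n ∈ range K, ‖coeff n Y‖ ^ 2
        + 2 * ε * ∑ n ∈ range K, (conj (coeff n Y) * coeff n (analyticSq f * Y)).re := by gcongr
    _ ≤ _ := by
        rw [mul_sum, ← sum_add_distrib]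
        exact sum_le_sum fun n _ => h2 n

theorem mulBound_outerMul {f : ℕ → ℂ} (hf : SqSummable f) {ε : ℝ} (hε : 0 < ε) :
    MulBound (outerMul f ε) 1 := by
  intro G K
  have h := outerMul_energy hf hε G K
  have : 0 ≤ 2 * ε * ∑ n ∈ range K, ‖coeff n (mk f * outerMul f ε * G)‖ ^ 2 := by positivity
  linarith

theorem mulBound_mk_mul_outerMul {f : ℕ → ℂ} (hf : SqSummable f) {ε : ℝ} (hε : 0 < ε) :
    MulBound (mk f * outerMul f ε) (1 / (2 * ε)) := by
  intro G K
  have h := outerMul_energy hf hε G K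
  have : 0 ≤ ∑ n ∈ range K, ‖coeff n (outerMul f ε * G)‖ ^ 2 := by positivity
  rw [one_div, ← div_eq_inv_mul, le_div_iff₀ (by positivity)]
  linarith

theorem tendsto_coeff_outerMul {f : ℕ → ℂ} (hf : SqSummable f) (n : ℕ) :
    Tendsto (fun i : ℕ => coeff n (outerMul f (1 / ((i : ℝ) + 1)))) atTop
      (𝓝 (coeff n (1 : ℂ⟦X⟧))) := by
  rw [tendsto_iff_norm_sub_tendsto_zero]
  have h0 : Tendsto (fun i : ℕ => 1 / ((i : ℝ) + 1)
      * ∑ p ∈ antidiagonal n, ‖coeff p.1 (analyticSq f)‖) atTop (𝓝 0) := by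
    simpa using (tendsto_one_div_add_atTop_nhds_zero_nat (𝕜 := ℝ)).mul_const
      (∑ p ∈ antidiagonal n, ‖coeff p.1 (analyticSq f)‖)
  refine squeeze_zero (fun _ => norm_nonneg _) (fun i => ?_) h0
  have hε : (0 : ℝ) < 1 / ((i : ℝ) + 1) := by positivity
  generalize 1 / ((i : ℝ) + 1) = ε at hε
  have hbd : ∀ k, ‖coeff k (outerMul f ε)‖ ≤ 1 := by
    intro k
    have h1 := mulBound_outerMul hf hε 1 (k + 1)
    have h2 : ∑ n ∈ range (k + 1), ‖coeff n (1 : ℂ⟦X⟧)‖ ^ 2 = 1 := by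
      rw [sum_eq_single 0] <;> simp +contextual [coeff_one]
    rw [h2, mul_one, mul_one] at h1
    have h3 := (single_le_sum (f := fun n => ‖coeff n (outerMul f ε)‖ ^ 2)
      (fun _ _ => by positivity) (self_mem_range_succ k)).trans h1
    exact (sq_le_one_iff₀ (norm_nonneg _)).1 h3
  have h4 : outerMul f ε - 1 = - (C (ε : ℂ) * (analyticSq f * outerMul f ε)) := by
    rw [← mul_outerMul f hε]; ring
  rw [← map_sub, h4, map_neg, norm_neg, coeff_C_mul, norm_mul, Complex.norm_real,
    Real.norm_of_nonneg hε.le, coeff_mul]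
  gcongr
  refine (norm_sum_le _ _).trans (sum_le_sum fun p _ => ?_)
  rw [norm_mul]
  exact mul_le_of_le_one_right (norm_nonneg _) (hbd _)

theorem tendsto_coeff_outerMul_mul {f : ℕ → ℂ} (hf : SqSummable f) (G : ℂ⟦X⟧) (n : ℕ) :
    Tendsto (fun i : ℕ => coeff n (outerMul f (1 / ((i : ℝ) + 1)) * G)) atTop
      (𝓝 (coeff n G)) := by
  conv => enter [3, 1]; rw [← one_mul G]
  simp_rw [coeff_mul]
  exact tendsto_finsetSum _ fun p _ => (tendsto_coeff_outerMul hf p.1).mul_const _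

theorem hankel_mk_X_pow_mul {u f : ℕ → ℂ} (hu : SqSummable u) (hf : SqSummable f) (m : ℕ) :
    hankel u (fun n => coeff n (X ^ m * mk f)) = fun n => hankel u f (n + m) := by
  funext n
  rw [hankel, (hasSum_mul_coeff_X_pow_mul (hu.shift n) (by simpa using hf) m).tsum_eq, hankel]
  exact tsum_congr fun k => by rw [coeff_mk]; congr 2; ring

theorem tsum_hankel_mul_multiplier {u f v : ℕ → ℂ} {H : ℂ⟦X⟧} {C D : ℝ} (hH : MulBound H C)
    (hfH : MulBound (mk f * H) D) (hu : SqSummable u) (hf : SqSummable f) (hv : SqSummable v)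
    (huf : SqSummable (hankel u f)) :
    ∑' n, hankel u f n * coeff n (H * mk v) = ∑' k, u k * coeff k (mk f * H * mk v) := by
  set V : ℕ → ℂ⟦X⟧ := fun M => mk fun n => if n < M then v n else 0 with hV
  have hVs : ∀ M, SqSummable fun n => coeff n (V M) := fun M =>
    summable_of_ne_finset_zero (s := range M) fun n hn => by
      simp [hV, (by simpa using hn : M ≤ n)]
  have hVle : ∀ M, ∑' n, ‖coeff n (V M)‖ ^ 2 ≤ ∑' n, ‖v n‖ ^ 2 := fun M =>
    Summable.tsum_le_tsum (fun n => by simp only [hV, coeff_mk]; split_ifs <;> simp) (hVs M) hv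
  have hlim : ∀ (F : ℂ⟦X⟧) (E : ℝ), MulBound F E → ∀ w : ℕ → ℂ, SqSummable w →
      Tendsto (fun M => ∑' n, w n * coeff n (F * V M)) atTop
        (𝓝 (∑' n, w n * coeff n (F * mk v))) := by
    intro F E hF w hw
    have hE : 0 ≤ E := by simpa using (sum_nonneg fun _ _ => by positivity).trans (hF 1 1)
    refine tendsto_tsum_mul_of_bounded hw (C := E * ∑' n, ‖v n‖ ^ 2)
      (fun M K => (hF.sum_range_mul_le (hVs M) K).trans (mul_le_mul_of_nonneg_left (hVle M) hE)) fun n => ?_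
    refine tendsto_const_nhds.congr' ?_
    filter_upwards [eventually_gt_atTop n] with M hM
    simp_rw [coeff_mul]
    refine sum_congr rfl fun p hp => ?_
    have := mem_antidiagonal.1 hp
    rw [hV, coeff_mk, coeff_mk, if_pos (by omega)]
  refine tendsto_nhds_unique (hlim H C hH _ huf) ((hlim _ D hfH u hu).congr fun M => ?_)
  rw [mul_comm H, mul_comm (mk f * H), hV, tsum_mul_coeff_mk_mul hu hfH.sqSummable,
    tsum_mul_coeff_mk_mul huf hH.sqSummable]
  refine sum_congr rfl fun m _ => ?_
  congr 1
  have h := tsum_mul_hankel_of_mulBound hH hu (sqSummable_coeff_X_pow_mul hf m)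
    (by rw [hankel_mk_X_pow_mul hu hf]; exact huf.shift m)
  rw [hankel_mk_X_pow_mul hu hf,
    show mk (fun n => coeff n (X ^ m * mk f)) = X ^ m * mk f by ext; simp,
    show H * (X ^ m * mk f) = X ^ m * (mk f * H) by ring,
    (hasSum_mul_coeff_X_pow_mul hu hfH.sqSummable m).tsum_eq] at h
  rw [← h]
  exact tsum_congr fun n => mul_comm _ _

/-- The maximal Hankel operator is symmetric for the bilinear pairing. -/
theorem tsum_hankel_mul_comm {u f v : ℕ → ℂ} (hu : SqSummable u) (hf : SqSummable f)
    (hv : SqSummable v) (huf : SqSummable (hankel u f)) (huv : SqSummable (hankel u v)) :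
    ∑' n, hankel u f n * v n = ∑' n, f n * hankel u v n := by
  have hf' : SqSummable fun n => coeff n (mk f) := by simpa using hf
  have hv' : SqSummable fun n => coeff n (mk v) := by simpa using hv
  have hpos : ∀ i : ℕ, (0 : ℝ) < 1 / ((i : ℝ) + 1) := fun i => by positivity
  have h1 := tendsto_tsum_mul_of_bounded huf
    (fun i => (mulBound_outerMul hf (hpos i)).sum_range_mul_le hv')
    (tendsto_coeff_outerMul_mul hf (mk v))
  have h2 := tendsto_tsum_mul_of_bounded huv
    (fun i => (mulBound_outerMul hf (hpos i)).sum_range_mul_le hf')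
    (tendsto_coeff_outerMul_mul hf (mk f))
  simp only [coeff_mk] at h1 h2
  simp_rw [mul_comm (f _)]
  refine tendsto_nhds_unique h1 (h2.congr fun i => ?_)
  rw [tsum_hankel_mul_multiplier (mulBound_outerMul hf (hpos i))
      (mulBound_mk_mul_outerMul hf (hpos i)) hu hf hv huf,
    ← tsum_mul_hankel_of_mulBound (mulBound_mk_mul_outerMul hf (hpos i)) hu hv huv]
  exact tsum_congr fun n => by rw [mul_comm, mul_comm (mk f)]

theorem ofReal_tsum_norm_sq (x : ℕ → ℂ) :
    ((∑' n, ‖x n‖ ^ 2 : ℝ) : ℂ) = ∑' n, x n * conj (x n) := by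
  rw [Complex.ofReal_tsum]
  exact tsum_congr fun n => by rw [Complex.mul_conj, Complex.normSq_eq_norm_sq]

theorem hankel_sharp (u g : ℕ → ℂ) (n : ℕ) :
    hankel (sharp u) g n = conj (hankel u (fun k => conj (g k)) n) := by
  rw [hankel, hankel, Complex.conj_tsum]
  simp [sharp]

theorem hankel_sub {u x y : ℕ → ℂ} (hu : SqSummable u) (hx : SqSummable x) (hy : SqSummable y) :
    hankel u (fun n => x n - y n) = fun n => hankel u x n - hankel u y n := by
  funext m
  rw [hankel, hankel, hankel,
    ← ((hu.shift m).summable_mul hx).tsum_sub ((hu.shift m).summable_mul hy)]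
  exact tsum_congr fun n => mul_sub _ _ _

section Resolvent

variable {u φ f : ℕ → ℂ} {lam : ℂ}

/-- The quadratic form identity for a solution of the resolvent equation. -/
theorem resolvent_energy (hu : SqSummable u) (hφ : SqSummable φ) (hf : SqSummable f)
    (h1 : SqSummable (hankel u φ))
    (h3 : hankel (sharp u) (hankel u φ) = fun n => lam * φ n + f n) :
    ((∑' n, ‖hankel u φ n‖ ^ 2 : ℝ) : ℂ)
      = conj lam * ((∑' n, ‖φ n‖ ^ 2 : ℝ) : ℂ) + ∑' n, φ n * conj (f n) := by
  have hv : hankel u (fun n => conj (hankel u φ n)) = fun n => conj (lam * φ n + f n) := by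
    funext n
    rw [← congrFun h3 n, hankel_sharp, Complex.conj_conj]
  have hs : SqSummable fun n => lam * φ n + f n := by
    refine SqSummable.add ?_ hf
    have := Summable.mul_left (‖lam‖ ^ 2) hφ
    simpa [SqSummable, mul_pow] using this
  rw [ofReal_tsum_norm_sq, ofReal_tsum_norm_sq,
    tsum_hankel_mul_comm hu hφ h1.star h1 (hv ▸ hs.star), hv, ← tsum_mul_left,
    ← ((hφ.summable_mul hφ.star).mul_left _).tsum_add (hφ.summable_mul hf.star)]
  exact tsum_congr fun n => by simp only [map_add, map_mul]; ring

theorem resolvent_im (hu : SqSummable u) (hφ : SqSummable φ) (hf : SqSummable f)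
    (h1 : SqSummable (hankel u φ))
    (h3 : hankel (sharp u) (hankel u φ) = fun n => lam * φ n + f n) :
    lam.im * ∑' n, ‖φ n‖ ^ 2 = (∑' n, φ n * conj (f n)).im := by
  have h := congrArg Complex.im (resolvent_energy hu hφ hf h1 h3)
  rw [Complex.add_im, Complex.im_mul_ofReal, Complex.conj_im, Complex.ofReal_im] at h
  linarith

theorem tsum_norm_sq_conj (f : ℕ → ℂ) : ∑' n, ‖conj (f n)‖ ^ 2 = ∑' n, ‖f n‖ ^ 2 := by
  simp

theorem resolvent_bound (hlam : lam.im ≠ 0) (hu : SqSummable u) (hφ : SqSummable φ)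
    (hf : SqSummable f) (h1 : SqSummable (hankel u φ))
    (h3 : hankel (sharp u) (hankel u φ) = fun n => lam * φ n + f n) :
    ∑' n, ‖φ n‖ ^ 2 ≤ (∑' n, ‖f n‖ ^ 2) / lam.im ^ 2 := by
  have h := resolvent_im hu hφ hf h1 h3
  have h2 := hφ.norm_tsum_mul_sq_le hf.star
  have h4 : (∑' n, φ n * conj (f n)).im ^ 2 ≤ ‖∑' n, φ n * conj (f n)‖ ^ 2 := by
    rw [← sq_abs]
    exact pow_le_pow_left₀ (abs_nonneg _) (Complex.abs_im_le_norm _) 2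
  rw [tsum_norm_sq_conj] at h2
  have hpos : 0 < lam.im ^ 2 := by positivity
  rw [← h] at h4
  rw [le_div_iff₀ hpos]
  rcases (tsum_nonneg fun n => by positivity : 0 ≤ ∑' n, ‖φ n‖ ^ 2).eq_or_lt with h0 | h0
  · rw [← h0, zero_mul]
    exact tsum_nonneg fun n => by positivity
  · exact le_of_mul_le_mul_left (by nlinarith) h0

theorem resolvent_hankel_bound (hlam : lam.im ≠ 0) (hu : SqSummable u) (hφ : SqSummable φ)
    (hf : SqSummable f) (h1 : SqSummable (hankel u φ))
    (h3 : hankel (sharp u) (hankel u φ) = fun n => lam * φ n + f n) :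
    ∑' n, ‖hankel u φ n‖ ^ 2 ≤ ‖lam‖ * ((∑' n, ‖f n‖ ^ 2) / lam.im ^ 2)
      + √((∑' n, ‖f n‖ ^ 2) / lam.im ^ 2) * √(∑' n, ‖f n‖ ^ 2) := by
  have hb := resolvent_bound hlam hu hφ hf h1 h3
  have h := congrArg norm (resolvent_energy hu hφ hf h1 h3)
  rw [Complex.norm_real, Real.norm_of_nonneg (tsum_nonneg fun n => by positivity)] at h
  rw [h]
  refine (norm_add_le _ _).trans (add_le_add ?_ ?_)
  · rw [norm_mul, RCLike.norm_conj, Complex.norm_real,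
      Real.norm_of_nonneg (tsum_nonneg fun n => by positivity)]
    exact mul_le_mul_of_nonneg_left hb (norm_nonneg _)
  · refine (hφ.norm_tsum_mul_le hf.star).trans ?_
    rw [tsum_norm_sq_conj]
    exact mul_le_mul_of_nonneg_right (Real.sqrt_le_sqrt hb) (Real.sqrt_nonneg _)

theorem resolvent_unique {y : ℕ → ℂ} (hlam : lam.im ≠ 0) (hu : SqSummable u)
    (hφ : SqSummable φ) (h1 : SqSummable (hankel u φ))
    (h3 : hankel (sharp u) (hankel u φ) = fun n => lam * φ n + f n)
    (hy : SqSummable y) (hy1 : SqSummable (hankel u y))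
    (hy3 : hankel (sharp u) (hankel u y) = fun n => lam * y n + f n) : y = φ := by
  have hz : SqSummable fun _ => (0 : ℂ) := by simp [SqSummable, summable_zero]
  have hu' : SqSummable (sharp u) := hu.star
  have h := resolvent_bound (f := fun _ => 0) hlam hu (hy.sub hφ) hz
    (by rw [hankel_sub hu hy hφ]; exact hy1.sub h1)
    (by
      rw [hankel_sub hu hy hφ, hankel_sub hu' hy1 h1, h3, hy3]
      funext n
      ring)
  funext n
  have h2 := ((hy.sub hφ).le_tsum n fun _ _ => by positivity).trans h
  have h4 : ‖y n - φ n‖ ^ 2 = 0 := le_antisymm (by simpa using h2) (by positivity)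
  exact sub_eq_zero.1 (norm_eq_zero.1 (pow_eq_zero_iff two_ne_zero |>.1 h4))

end Resolvent

theorem tendsto_hankel {ι : Type*} {l : Filter ι} {w x : ι → ℕ → ℂ} {v y : ℕ → ℂ} {C : ℝ}
    (hw : ∀ i, SqSummable (w i)) (hv : SqSummable v)
    (hwv : Tendsto (fun i => ∑' n, ‖w i n - v n‖ ^ 2) l (𝓝 0))
    (hC : ∀ i K, ∑ n ∈ range K, ‖x i n‖ ^ 2 ≤ C)
    (hx : ∀ n, Tendsto (fun i => x i n) l (𝓝 (y n))) (m : ℕ) :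
    Tendsto (fun i => hankel (w i) (x i) m) l (𝓝 (hankel v y m)) := by
  refine tendsto_tsum_mul_of_tendsto (fun i => (hw i).shift m) (hv.shift m) ?_ hC hx
  refine squeeze_zero (fun i => tsum_nonneg fun n => by positivity) (fun i => ?_) hwv
  rw [← Summable.sum_add_tsum_nat_add m ((hw i).sub hv)]
  exact le_add_of_nonneg_left (sum_nonneg fun _ _ => by positivity)

theorem exists_tendsto_ultrafilter_of_bounded {ι : Type*} (U : Ultrafilter ι) {x : ι → ℂ} {R : ℝ}
    (hx : ∀ i, ‖x i‖ ≤ R) : ∃ y, Tendsto x U (𝓝 y) := by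
  obtain ⟨y, -, hy⟩ := (isCompact_closedBall (0 : ℂ) R).ultrafilter_le_nhds (U.map x)
    (by
      rw [le_principal_iff, Ultrafilter.coe_map, Filter.mem_map]
      exact univ_mem' fun i => by simpa using hx i)
  exact ⟨y, hy⟩

/-- Strong resolvent convergence in terms of sequences. -/
theorem tendsto_tsum_sq_sub_of_resolvent {uk φk : ℕ → ℕ → ℂ} {u φ f : ℕ → ℂ} {lam : ℂ}
    (huk : ∀ k, SqSummable (uk k)) (hu : SqSummable u)
    (hlim : Tendsto (fun k => ∑' n, ‖uk k n - u n‖ ^ 2) atTop (𝓝 0)) (hlam : lam.im ≠ 0)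
    (hf : SqSummable f) (hφk : ∀ k, SqSummable (φk k)) (hφ : SqSummable φ)
    (hk1 : ∀ k, SqSummable (hankel (uk k) (φk k)))
    (hk3 : ∀ k, hankel (sharp (uk k)) (hankel (uk k) (φk k)) = fun n => lam * φk k n + f n)
    (h1 : SqSummable (hankel u φ))
    (h3 : hankel (sharp u) (hankel u φ) = fun n => lam * φ n + f n) :
    Tendsto (fun k => ∑' n, ‖φk k n - φ n‖ ^ 2) atTop (𝓝 0) := by
  obtain ⟨C, hC⟩ : ∃ C, ∀ k K, ∑ n ∈ range K, ‖φk k n‖ ^ 2 ≤ C := ⟨_, fun k K =>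
    ((hφk k).sum_range_le K).trans (resolvent_bound hlam (huk k) (hφk k) hf (hk1 k) (hk3 k))⟩
  obtain ⟨D, hD⟩ : ∃ D, ∀ k K, ∑ n ∈ range K, ‖hankel (uk k) (φk k) n‖ ^ 2 ≤ D :=
    ⟨_, fun k K => ((hk1 k).sum_range_le K).trans
      (resolvent_hankel_bound hlam (huk k) (hφk k) hf (hk1 k) (hk3 k))⟩
  have hcoord : ∀ n, Tendsto (fun k => φk k n) atTop (𝓝 (φ n)) := by
    intro n
    rw [tendsto_iff_ultrafilter]
    intro U hU
    have hex : ∀ n, ∃ y, Tendsto (fun k => φk k n) U (𝓝 y) := fun n =>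
      exists_tendsto_ultrafilter_of_bounded U (R := √C) fun k => Real.le_sqrt_of_sq_le <|
        (single_le_sum (f := fun n => ‖φk k n‖ ^ 2) (fun _ _ => by positivity)
          (self_mem_range_succ n)).trans (hC k (n + 1))
    choose y hy using hex
    have hψ := tendsto_hankel huk hu (hlim.mono_left hU) hC hy
    have hlim' : Tendsto (fun k => ∑' n, ‖sharp (uk k) n - sharp u n‖ ^ 2) U (𝓝 0) := by
      refine (hlim.mono_left hU).congr fun k => tsum_congr fun n => ?_
      rw [sharp, sharp, ← map_sub, RCLike.norm_conj]
    have hψ' := tendsto_hankel (w := fun k => sharp (uk k)) (v := sharp u)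
      (fun k => (huk k).star) hu.star hlim' hD hψ
    have hy3 : hankel (sharp u) (hankel u y) = fun n => lam * y n + f n := by
      funext m
      refine tendsto_nhds_unique (hψ' m) ?_
      simp_rw [hk3]
      exact ((hy m).const_mul lam).add_const _
    have hyφ : y = φ := resolvent_unique hlam hu hφ h1 h3
      (.of_sum_range_le (sum_range_le_of_tendsto hC hy))
      (.of_sum_range_le (sum_range_le_of_tendsto hD hψ)) hy3
    exact hyφ ▸ hy n
  have hnorm : Tendsto (fun k => ∑' n, ‖φk k n‖ ^ 2) atTop (𝓝 (∑' n, ‖φ n‖ ^ 2)) := by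
    have h : Tendsto (fun k => (∑' n, conj (f n) * φk k n).im / lam.im) atTop
        (𝓝 ((∑' n, conj (f n) * φ n).im / lam.im)) :=
      ((Complex.continuous_im.tendsto _).comp
        (tendsto_tsum_mul_of_bounded hf.star hC hcoord)).div_const _
    have h' : ∀ s t : ℝ, lam.im * s = t → t / lam.im = s := fun s t hst => by
      rw [← hst, mul_div_cancel_left₀ _ hlam]
    simp_rw [mul_comm (conj (f _))] at h
    rw [h' _ _ (resolvent_im hu hφ hf h1 h3)] at h
    exact h.congr fun k => h' _ _ (resolvent_im (huk k) (hφk k) hf (hk1 k) (hk3 k))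
  have hcross : Tendsto (fun k => (∑' n, conj (φ n) * φk k n).re) atTop (𝓝 (∑' n, ‖φ n‖ ^ 2)) := by
    have h := (Complex.continuous_re.tendsto _).comp
      (tendsto_tsum_mul_of_bounded hφ.star hC hcoord)
    have h0 : (∑' n, conj (φ n) * φ n).re = ∑' n, ‖φ n‖ ^ 2 := by
      simp_rw [mul_comm (conj (φ _))]
      rw [← ofReal_tsum_norm_sq, Complex.ofReal_re]
    rwa [h0] at h
  have h := (hnorm.add_const (∑' n, ‖φ n‖ ^ 2)).sub (hcross.const_mul 2)
  rw [show ∀ s : ℝ, s + s - 2 * s = 0 from fun s => by ring] at h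
  refine h.congr fun k => ?_
  rw [Complex.re_tsum (hφ.star.summable_mul (hφk k)), ← tsum_mul_left,
    ← Summable.tsum_add (hφk k) hφ, ← Summable.tsum_sub (Summable.add (hφk k) hφ)
      ((Complex.hasSum_re (hφ.star.summable_mul (hφk k)).hasSum).summable.mul_left 2)]
  refine tsum_congr fun n => ?_
  simp only [← Complex.normSq_eq_norm_sq, Complex.normSq_apply, Complex.mul_re, Complex.conj_re,
    Complex.conj_im, Complex.sub_re, Complex.sub_im]
  ring

end HankelSymmetry

/-- Strong resolvent convergence of `Γ_{u_k}*Γ_{u_k}` to `Γ_u*Γ_u` when `u_k → u` in `ℓ²`: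
if `Im λ ≠ 0` and `φ_k`, `φ` solve the resolvent equations
`Γ_{u_k♯}(Γ_{u_k} φ_k) = λ φ_k + f` and `Γ_{u♯}(Γ_u φ) = λ φ + f` (with the stated domain
conditions), then `‖φ_k − φ‖ → 0`. -/
theorem stmt_5 (u : ellTwo) (uk : ℕ → ellTwo)
    (hu : Tendsto (fun k => ‖uk k - u‖) atTop (nhds 0))
    (lam : ℂ) (hlam : lam.im ≠ 0) (f : ellTwo)
    (φk : ℕ → ellTwo) (φ : ellTwo)
    (hk1 : ∀ k, Memℓp (hankel (⇑(uk k)) (⇑(φk k))) 2)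
    (hk2 : ∀ k, Memℓp (hankel (sharp (⇑(uk k))) (hankel (⇑(uk k)) (⇑(φk k)))) 2)
    (hk3 : ∀ k, hankel (sharp (⇑(uk k))) (hankel (⇑(uk k)) (⇑(φk k)))
      = fun n => lam * (⇑(φk k) : ℕ → ℂ) n + (⇑f : ℕ → ℂ) n)
    (h1 : Memℓp (hankel (⇑u) (⇑φ)) 2)
    (h2 : Memℓp (hankel (sharp (⇑u)) (hankel (⇑u) (⇑φ))) 2)
    (h3 : hankel (sharp (⇑u)) (hankel (⇑u) (⇑φ))
      = fun n => lam * (⇑φ : ℕ → ℂ) n + (⇑f : ℕ → ℂ) n) :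
    Tendsto (fun k => ‖φk k - φ‖) atTop (nhds 0) := by
  have hs : ∀ x : ellTwo, SqSummable x := fun x => memlp_two_iff_sqSummable.1 (lp.memℓp x)
  have hn : ∀ x y : ellTwo, ‖x - y‖ ^ 2 = ∑' n, ‖x n - y n‖ ^ 2 := fun x y => by
    simpa using lp.norm_rpow_eq_tsum (p := 2) (by norm_num) (x - y)
  have h := tendsto_tsum_sq_sub_of_resolvent (fun k => hs (uk k)) (hs u)
    (by simpa [hn] using hu.pow 2) hlam (hs f) (fun k => hs (φk k)) (hs φ)
    (fun k => memlp_two_iff_sqSummable.1 (hk1 k)) hk3 (memlp_two_iff_sqSummable.1 h1) h3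
  simp_rw [← hn] at h
  simpa [Function.comp_def] using (Real.continuous_sqrt.tendsto _).comp h
end
end

section
/- Let u ∈ ℓ²(ℕ, ℂ) and let H_u be the anti-linear Hankel operator H_u f = Γ_u(f̄) on Dom H_u = {f ∈ ℓ² : Γ_u(f̄) ∈ ℓ²}. Suppose f, h ∈ ℓ² satisfy ⟨H_u g, f⟩ = ⟨h, g⟩ for every g ∈ Dom H_u. Then f ∈ Dom H_u and H_u f = h. -/
open scoped ComplexConjugate
open Filter

noncomputable section

/-- The anti-linear Hankel operator `H_u f = Γ_u (conj f)`:
`(H_u f)(m) = ∑_n u(n+m) conj (f n)`. -/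
def aHankel (u f : ℕ → ℂ) : ℕ → ℂ := hankel u (fun n => conj (f n))

/-- The anti-linear Hankel matrix sends the `k`-th basis vector to its `k`-th column. -/
theorem aHankel_single (u : ℕ → ℂ) (k : ℕ) :
    aHankel u (⇑(lp.single 2 k (1 : ℂ) : ellTwo)) = fun m => u (k + m) := by
  funext m
  unfold aHankel hankel
  rw [tsum_eq_single k]
  · simp
  · intro n hn
    simp [lp.single_apply, hn]

/-- Pairing with the `k`-th basis vector reads off the `k`-th coordinate. -/
theorem ip_single (h : ℕ → ℂ) (k : ℕ) :
    ip h (⇑(lp.single 2 k (1 : ℂ) : ellTwo)) = h k := by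
  unfold ip
  rw [tsum_eq_single k]
  · simp
  · intro n hn
    simp [lp.single_apply, hn]

/-- Square summability is preserved by shifts. -/
theorem Memℓp.shift_two {u : ℕ → ℂ} (hu : Memℓp u 2) (k : ℕ) :
    Memℓp (fun m => u (k + m)) 2 := by
  have h_pos : 0 < (2 : ENNReal).toReal := by norm_num
  exact memℓp_gen ((hu.summable h_pos).comp_injective (add_right_injective k))

/-- If `⟨H_u g, f⟩ = ⟨h, g⟩` for every `g ∈ Dom H_u`, then `f ∈ Dom H_u` and `H_u f = h`. -/
theorem stmt_6 (u : ellTwo) (f h : ellTwo)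
    (hyp : ∀ g : ellTwo, Memℓp (aHankel (⇑u) (⇑g)) 2 →
      ip (aHankel (⇑u) (⇑g)) (⇑f) = ip (⇑h) (⇑g)) :
    Memℓp (aHankel (⇑u) (⇑f)) 2 ∧ aHankel (⇑u) (⇑f) = ⇑h := by
  have h_eq : aHankel (⇑u) (⇑f) = ⇑h := by
    funext k
    have hk := hyp (lp.single 2 k (1 : ℂ)) (by
      rw [aHankel_single]
      exact (lp.memℓp u).shift_two k)
    rw [aHankel_single, ip_single] at hk
    rw [← hk]
    simp only [aHankel, hankel, ip, add_comm]
  exact ⟨h_eq ▸ lp.memℓp h, h_eq⟩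
end
end

section
/- Let S be the unilateral shift on ℓ²(ℕ, ℂ), (Sf)(0) = 0 and (Sf)(n+1) = f(n). Then the self-adjoint bounded operator Re S = (S + S*)/2 (the free Jacobi matrix, with matrix entries 1/2 on the two off-diagonals next to the main diagonal and 0 elsewhere) has spectrum equal to the interval [−1, 1]. -/
open scoped ComplexConjugate

noncomputable section

/-- The unilateral shift: `(Sf)(0) = 0`, `(Sf)(n+1) = f(n)`. -/
def shiftFun (f : ℕ → ℂ) : ℕ → ℂ := fun n => match n with
  | 0 => 0
  | Nat.succ m => f m

open Filter Topology

/-- Square-summable sequences tend to zero. -/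
theorem ellTwo_tendsto_norm_zero (g : ellTwo) :
    Tendsto (fun n => ‖(⇑g : ℕ → ℂ) n‖) atTop (𝓝 0) := by
  have h := ((lp.memℓp g).summable (by norm_num)).tendsto_atTop_zero
  simp only [ENNReal.toReal_ofNat, Real.rpow_ofNat] at h
  simpa using h.sqrt

/-- A square-summable sequence multiplied by a unimodular number at each step vanishes. -/
theorem eq_zero_of_tendsto_of_norm_succ {h : ℕ → ℂ}
    (hlim : Tendsto (fun n => ‖h n‖) atTop (𝓝 0)) (hn : ∀ n, ‖h (n + 1)‖ = ‖h n‖) (n : ℕ) :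
    h n = 0 := by
  have hc : ∀ m, ‖h m‖ = ‖h 0‖ := fun m => by
    induction m with
    | zero => rfl
    | succ m ih => rw [hn, ih]
  simp only [hc] at hlim
  rw [← norm_eq_zero, hc, tendsto_nhds_unique tendsto_const_nhds hlim]

section

variable {T : ellTwo →L[ℂ] ellTwo}

/-- The free Jacobi matrix is a contraction. -/
theorem norm_freeJacobi_le_one (hT : ∀ f : ellTwo, ∀ n : ℕ,
    (⇑(T f) : ℕ → ℂ) n = (shiftFun (⇑f) n + (⇑f : ℕ → ℂ) (n + 1)) / 2) : ‖T‖ ≤ 1 := by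
  refine T.opNorm_le_bound zero_le_one fun f => ?_
  rw [one_mul]
  refine lp.norm_le_of_forall_sum_le (by norm_num) (norm_nonneg f) fun s => ?_
  obtain ⟨N, hN⟩ := s.exists_nat_subset_range
  have hp : ∀ N, ∑ n ∈ Finset.range N, ‖(⇑f : ℕ → ℂ) n‖ ^ 2 ≤ ‖f‖ ^ 2 := fun N => by
    simpa using lp.sum_rpow_le_norm_rpow (p := 2) (by norm_num) f (Finset.range N)
  have hs : ∑ n ∈ Finset.range N, ‖shiftFun (⇑f) n‖ ^ 2 ≤ ‖f‖ ^ 2 := by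
    cases N with
    | zero => simp
    | succ N => simpa [Finset.sum_range_succ', shiftFun] using hp N
  have hb : ∑ n ∈ Finset.range N, ‖(⇑f : ℕ → ℂ) (n + 1)‖ ^ 2 ≤ ‖f‖ ^ 2 := by
    have := hp (N + 1)
    rw [Finset.sum_range_succ'] at this
    nlinarith [sq_nonneg ‖(⇑f : ℕ → ℂ) 0‖]
  simp only [ENNReal.toReal_ofNat, Real.rpow_ofNat]
  calc ∑ n ∈ s, ‖(⇑(T f) : ℕ → ℂ) n‖ ^ 2
      ≤ ∑ n ∈ Finset.range N, ‖(⇑(T f) : ℕ → ℂ) n‖ ^ 2 :=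
        Finset.sum_le_sum_of_subset_of_nonneg hN fun _ _ _ => by positivity
    _ ≤ ∑ n ∈ Finset.range N, (‖shiftFun (⇑f) n‖ ^ 2 + ‖(⇑f : ℕ → ℂ) (n + 1)‖ ^ 2) / 2 := by
        gcongr with n
        rw [hT, norm_div, Complex.norm_ofNat]
        have := norm_add_le (shiftFun (⇑f) n) ((⇑f : ℕ → ℂ) (n + 1))
        nlinarith [norm_nonneg (shiftFun (⇑f) n + (⇑f : ℕ → ℂ) (n + 1)),
          sq_nonneg (‖shiftFun (⇑f) n‖ - ‖(⇑f : ℕ → ℂ) (n + 1)‖)]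
    _ ≤ ‖f‖ ^ 2 := by
        rw [← Finset.sum_div, Finset.sum_add_distrib]
        linarith

/-- The free Jacobi matrix is self-adjoint. -/
theorem isSelfAdjoint_freeJacobi (hT : ∀ f : ellTwo, ∀ n : ℕ,
    (⇑(T f) : ℕ → ℂ) n = (shiftFun (⇑f) n + (⇑f : ℕ → ℂ) (n + 1)) / 2) : IsSelfAdjoint T := by
  rw [ContinuousLinearMap.isSelfAdjoint_iff']
  refine lp.ext_continuousLinearMap (by norm_num) fun i => ?_
  ext j
  have h := ContinuousLinearMap.adjoint_inner_right T (lp.single 2 j (1 : ℂ))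
    (lp.single 2 i (1 : ℂ))
  rw [lp.inner_single_left, lp.inner_single_right, hT] at h
  simp only [RCLike.inner_apply, map_one, mul_one, one_mul] at h
  simp only [ContinuousLinearMap.comp_apply, lp.singleContinuousLinearMap_apply]
  rw [h, hT]
  clear h hT
  have h2 : (starRingEnd ℂ) 2 = 2 := Complex.conj_ofNat 2
  rcases i with _ | i <;> rcases j with _ | j <;>
    simp [shiftFun, lp.single_apply, Pi.single_apply, h2]; grind

/-- Each `(z + z⁻¹) / 2` with `z` unimodular is in the spectrum of the free Jacobi matrix. -/
theorem mem_spectrum_freeJacobi (hT : ∀ f : ellTwo, ∀ n : ℕ,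
    (⇑(T f) : ℕ → ℂ) n = (shiftFun (⇑f) n + (⇑f : ℕ → ℂ) (n + 1)) / 2)
    {z : ℂ} (hz : ‖z‖ = 1) : (z + z⁻¹) / 2 ∈ spectrum ℂ T := by
  rw [spectrum.mem_iff]
  intro hu
  have hz0 : z ≠ 0 := by rintro rfl; simp at hz
  obtain ⟨R, hR⟩ := hu.exists_right_inv
  set g : ellTwo := R (lp.single 2 0 (1 : ℂ))
  have hRg : ((z + z⁻¹) / 2) • g - T g = lp.single 2 0 (1 : ℂ) := by
    have := congrArg (fun A : ellTwo →L[ℂ] ellTwo => A (lp.single 2 0 (1 : ℂ))) hR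
    simpa [Algebra.algebraMap_eq_smul_one] using this
  have hcoord : ∀ n, (z + z⁻¹) / 2 * (⇑g : ℕ → ℂ) n
      - (shiftFun (⇑g) n + (⇑g : ℕ → ℂ) (n + 1)) / 2 = if n = 0 then 1 else 0 := fun n => by
    have h : (z + z⁻¹) / 2 * (⇑g : ℕ → ℂ) n - (⇑(T g) : ℕ → ℂ) n
        = (⇑(lp.single 2 0 (1 : ℂ) : ellTwo) : ℕ → ℂ) n :=
      congrArg (fun f : ellTwo => (⇑f : ℕ → ℂ) n) hRg
    rw [← hT, h, lp.single_apply, Pi.single_apply]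
  have hlim := ellTwo_tendsto_norm_zero g
  have hlim1 := (tendsto_add_atTop_iff_nat 1).2 hlim
  have hsucc : ∀ n, (⇑g : ℕ → ℂ) (n + 1) - z * (⇑g : ℕ → ℂ) n = 0 := by
    refine eq_zero_of_tendsto_of_norm_succ ?_ fun n => ?_
    · refine squeeze_zero (fun n => norm_nonneg _) (fun n => norm_sub_le _ _) ?_
      simpa [hz] using hlim1.add hlim
    · have h := hcoord (n + 1)
      simp only [shiftFun, Nat.add_eq_zero_iff, one_ne_zero, and_false, if_false] at h
      have : (⇑g : ℕ → ℂ) (n + 1 + 1) - z * (⇑g : ℕ → ℂ) (n + 1)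
          = z⁻¹ * ((⇑g : ℕ → ℂ) (n + 1) - z * (⇑g : ℕ → ℂ) n) := by
        linear_combination (-2) * h + (⇑g : ℕ → ℂ) n * (inv_mul_cancel₀ hz0)
      rw [this, norm_mul, norm_inv, hz, inv_one, one_mul]
  have hzero : ∀ n, (⇑g : ℕ → ℂ) n = 0 := eq_zero_of_tendsto_of_norm_succ hlim fun n => by
    rw [sub_eq_zero.1 (hsucc n), norm_mul, hz, one_mul]
  simpa [hzero, shiftFun] using hcoord 0

end

/-- The real part of the shift, `Re S = (S + S*)/2` (the free Jacobi matrix), has spectrum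
equal to the interval `[−1, 1]`. Here `T` is the bounded operator on `ℓ²(ℕ, ℂ)` acting by
`(T f)(n) = ((S f)(n) + f(n+1))/2`. -/
theorem stmt_10 (T : ellTwo →L[ℂ] ellTwo)
    (hT : ∀ f : ellTwo, ∀ n : ℕ,
      (⇑(T f) : ℕ → ℂ) n = (shiftFun (⇑f) n + (⇑f : ℕ → ℂ) (n + 1)) / 2) :
    spectrum ℂ T = Complex.ofReal '' Set.Icc (-1 : ℝ) 1 := by
  apply Set.Subset.antisymm
  · intro k hk
    have hre := (isSelfAdjoint_freeJacobi hT).mem_spectrum_eq_re hk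
    refine ⟨k.re, ?_, hre.symm⟩
    rw [Set.mem_Icc, ← abs_le]
    have : Nontrivial ellTwo :=
      ⟨lp.single 2 0 (1 : ℂ), 0, fun h => by
        simpa using congrArg (fun f : ellTwo => (⇑f : ℕ → ℂ) 0) h⟩
    exact (Complex.abs_re_le_norm k).trans
      ((spectrum.norm_le_norm_of_mem hk).trans (norm_freeJacobi_le_one hT))
  · rintro _ ⟨x, hx, rfl⟩
    have h := mem_spectrum_freeJacobi hT (Complex.norm_exp_ofReal_mul_I (Real.arccos x))
    rwa [← Complex.exp_neg, ← neg_mul, ← Complex.cos, ← Complex.ofReal_cos,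
      Real.cos_arccos hx.1 hx.2] at h
end
end
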